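/- arXiv:1209.4575 — 3 statements merged into one kernel-verified Lean document; each statement's English description precedes it below -/
import Mathlib

section
/- Let T ⊆ B(H,K) be a TRO, X ⊆ T a sub-TRO, and P : T → X a contractive TRO conditional expectation onto X. Then for every n ∈ ℕ and all b₁,…,bₙ ∈ T, x₁,…,xₙ ∈ X, one has ‖∑_{i=1}^n P(bᵢ) xᵢ*‖ ≤ ‖∑_{i=1}^n bᵢ xᵢ*‖ (norms in B(K), where bᵢ xᵢ* denotes the composition bᵢ ∘ xᵢ*). -/
noncomputable section

open ContinuousLinearMap

/-- The closed linear span of a set in a complex normed space. -/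
def cspan {V : Type*} [NormedAddCommGroup V] [NormedSpace ℂ V] (S : Set V) : Set V :=
  closure (Submodule.span ℂ S : Set V)

variable {H K : Type*} [NormedAddCommGroup H] [InnerProductSpace ℂ H] [CompleteSpace H]
  [NormedAddCommGroup K] [InnerProductSpace ℂ K] [CompleteSpace K]

/-- The ternary product `a b* c` of operators in `B(H,K)`. -/
def tp (a b c : H →L[ℂ] K) : H →L[ℂ] K :=
  a ∘L ((ContinuousLinearMap.adjoint b) ∘L c)

/-- A TRO: a norm-closed linear subspace of `B(H,K)` stable under `(a,b,c) ↦ a b* c`. -/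
def IsTRO (T : Set (H →L[ℂ] K)) : Prop :=
  IsClosed T ∧ (∃ S : Submodule ℂ (H →L[ℂ] K), T = ↑S) ∧
    ∀ a ∈ T, ∀ b ∈ T, ∀ c ∈ T, tp a b c ∈ T

/-- A sub-TRO of `T`: a norm-closed linear subspace of `T` stable under the ternary product. -/
def IsSubTRO (T X : Set (H →L[ℂ] K)) : Prop :=
  X ⊆ T ∧ IsClosed X ∧ (∃ S : Submodule ℂ (H →L[ℂ] K), X = ↑S) ∧
    ∀ a ∈ X, ∀ b ∈ X, ∀ c ∈ X, tp a b c ∈ X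

/-- The set `{a b* : a ∈ T₁, b ∈ T₂} ⊆ B(K)`. -/
def setMulStar (T₁ T₂ : Set (H →L[ℂ] K)) : Set (K →L[ℂ] K) :=
  {w | ∃ a ∈ T₁, ∃ b ∈ T₂, w = a ∘L ContinuousLinearMap.adjoint b}

/-- The set `{a* b : a ∈ T₁, b ∈ T₂} ⊆ B(H)`. -/
def setStarMul (T₁ T₂ : Set (H →L[ℂ] K)) : Set (H →L[ℂ] H) :=
  {w | ∃ a ∈ T₁, ∃ b ∈ T₂, w = ContinuousLinearMap.adjoint a ∘L b}

/-- Nondegeneracy of a sub-TRO `X ⊆ T`: `⟨X T* T⟩ = T` and `⟨T T* X⟩ = T`. -/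
def Nondegenerate (T X : Set (H →L[ℂ] K)) : Prop :=
  cspan {w | ∃ x ∈ X, ∃ a ∈ T, ∃ b ∈ T, w = tp x a b} = T ∧
  cspan {w | ∃ a ∈ T, ∃ b ∈ T, ∃ x ∈ X, w = tp a b x} = T

/-- A TRO conditional expectation from `T` onto the sub-TRO `X`: a linear idempotent
surjection `P : T → X` (formalised as a map of the ambient space which is linear on `T`,
maps `T` into `X` and fixes `X`) satisfying the three module identities. -/
def IsTROCondExp (T X : Set (H →L[ℂ] K)) (P : (H →L[ℂ] K) → (H →L[ℂ] K)) : Prop :=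
  (∀ s ∈ T, ∀ t ∈ T, P (s + t) = P s + P t) ∧
  (∀ (z : ℂ), ∀ t ∈ T, P (z • t) = z • P t) ∧
  (∀ t ∈ T, P t ∈ X) ∧ (∀ x ∈ X, P x = x) ∧
  (∀ a ∈ T, ∀ x ∈ X, ∀ y ∈ X, P (tp a x y) = tp (P a) x y) ∧
  (∀ a ∈ T, ∀ x ∈ X, ∀ y ∈ X, P (tp x a y) = tp x (P a) y) ∧
  (∀ a ∈ T, ∀ x ∈ X, ∀ y ∈ X, P (tp x y a) = tp x y (P a))

/-- `P` is contractive on the set `S`. -/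
def ContractiveOn {V W : Type*} [Norm V] [Norm W] (S : Set V) (P : V → W) : Prop :=
  ∀ v ∈ S, ‖P v‖ ≤ ‖v‖

/-- A self-adjoint element whose powers satisfy `‖a ^ (k + 1)‖ ≤ M * q ^ k` has norm at most `q`. -/
lemma IsSelfAdjoint.norm_le_of_norm_pow_succ_le {A : Type*} [NormedRing A] [StarRing A]
    [CStarRing A] {a : A} (ha : IsSelfAdjoint a) {M q : ℝ} (hM : 0 ≤ M) (hq : 0 ≤ q)
    (h : ∀ k : ℕ, ‖a ^ (k + 1)‖ ≤ M * q ^ k) : ‖a‖ ≤ q := by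
  by_contra! hlt
  have hr : 0 < ‖a‖ := hq.trans_lt hlt
  have hbound : ∀ m : ℕ, ‖a‖ ≤ M * (q / ‖a‖) ^ m := by
    intro m
    have hm : 2 ^ m - 1 + 1 = 2 ^ m := Nat.sub_add_cancel Nat.one_le_two_pow
    have hnorm : ‖a ^ 2 ^ m‖ = ‖a‖ ^ 2 ^ m := congrArg NNReal.toReal (ha.nnnorm_pow_two_pow m)
    have hk := h (2 ^ m - 1)
    rw [hm, hnorm, ← hm, pow_succ', hm] at hk
    have hmle : m ≤ 2 ^ m - 1 := Nat.le_sub_one_of_lt Nat.lt_two_pow_self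
    calc ‖a‖ ≤ M * (q / ‖a‖) ^ (2 ^ m - 1) := by
          rw [div_pow, ← mul_div_assoc, le_div_iff₀ (by positivity)]
          exact hk
      _ ≤ M * (q / ‖a‖) ^ m := by
          gcongr M * ?_
          exact pow_le_pow_of_le_one (by positivity) (div_le_one_of_le₀ hlt.le hr.le) hmle
  have hlim := (tendsto_pow_atTop_nhds_zero_of_lt_one (by positivity)
    ((div_lt_one hr).2 hlt)).const_mul M
  rw [mul_zero] at hlim
  exact hr.not_ge (ge_of_tendsto' hlim hbound)

/-- If left multiplication by `R` is bounded by `c` on a set `X` invariant under `R*`,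
then so is left multiplication by `R*`. -/
lemma norm_adjoint_comp_le {X : Set (H →L[ℂ] K)} {R : K →L[ℂ] K} {c : ℝ}
    (hR' : ∀ z ∈ X, adjoint R ∘L z ∈ X) (hc : ∀ z ∈ X, ‖R ∘L z‖ ≤ c * ‖z‖)
    {z : H →L[ℂ] K} (hz : z ∈ X) : ‖adjoint R ∘L z‖ ≤ c * ‖z‖ := by
  set w := adjoint R ∘L z with hw
  have hsq : ‖w‖ * ‖w‖ ≤ ‖z‖ * (c * ‖w‖) := by
    rw [← norm_adjoint_comp_self w]
    have hfact : adjoint w ∘L w = adjoint z ∘L (R ∘L w) := by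
      conv_lhs => rw [hw, adjoint_comp, adjoint_adjoint, ← hw, comp_assoc]
    rw [hfact]
    refine (opNorm_comp_le _ _).trans ?_
    rw [LinearIsometryEquiv.norm_map]
    gcongr
    exact hc w (hR' z hz)
  rcases (norm_nonneg w).eq_or_lt with h0 | hpos
  · have hcz := (norm_nonneg _).trans (hc z hz)
    rwa [← h0]
  · exact le_of_mul_le_mul_right (by linarith) hpos

/-- If `R = ∑ yᵢ xᵢ*` with `xᵢ ∈ X`, where `X` is invariant under left multiplication by `R`
and `R*`, then `‖R‖` is bounded by the norm of left multiplication by `R` on `X`. -/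
lemma norm_sum_comp_adjoint_le {X : Set (H →L[ℂ] K)} {ι : Type*} [Fintype ι]
    {x y : ι → H →L[ℂ] K} (hx : ∀ i, x i ∈ X) {R : K →L[ℂ] K}
    (hsum : R = ∑ i, y i ∘L adjoint (x i)) {c : ℝ} (hc0 : 0 ≤ c)
    (hR : ∀ z ∈ X, R ∘L z ∈ X) (hR' : ∀ z ∈ X, adjoint R ∘L z ∈ X)
    (hc : ∀ z ∈ X, ‖R ∘L z‖ ≤ c * ‖z‖) : ‖R‖ ≤ c := by
  have hstep : ∀ z ∈ X, ‖(R * adjoint R) ∘L z‖ ≤ c * c * ‖z‖ := fun z hz =>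
    calc ‖(R * adjoint R) ∘L z‖ ≤ c * ‖adjoint R ∘L z‖ := by
          rw [mul_def, comp_assoc]; exact hc _ (hR' z hz)
      _ ≤ c * (c * ‖z‖) := by gcongr; exact norm_adjoint_comp_le hR' hc hz
      _ = c * c * ‖z‖ := by ring
  have hpow : ∀ (k : ℕ), ∀ z ∈ X, ‖((R * adjoint R) ^ k) ∘L z‖ ≤ (c * c) ^ k * ‖z‖ := by
    intro k
    induction k with
    | zero => intro z _; simp [one_def]
    | succ k ih =>
      intro z hz
      calc ‖((R * adjoint R) ^ (k + 1)) ∘L z‖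
          = ‖((R * adjoint R) ^ k) ∘L ((R * adjoint R) ∘L z)‖ := by
            rw [pow_succ, mul_def, comp_assoc]
        _ ≤ (c * c) ^ k * ‖(R * adjoint R) ∘L z‖ := by
            refine ih _ ?_
            rw [mul_def, comp_assoc]
            exact hR _ (hR' z hz)
        _ ≤ (c * c) ^ k * (c * c * ‖z‖) := by gcongr; exact hstep z hz
        _ = (c * c) ^ (k + 1) * ‖z‖ := by ring
  have hadj : adjoint R = ∑ i, x i ∘L adjoint (y i) := by
    rw [hsum, map_sum]
    simp [adjoint_comp]
  have hself : IsSelfAdjoint (R * adjoint R) := IsSelfAdjoint.mul_star_self R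
  have hle : ‖R * adjoint R‖ ≤ c * c := by
    refine hself.norm_le_of_norm_pow_succ_le (M := ∑ i, ‖R ∘L x i‖ * ‖y i‖)
      (by positivity) (by positivity) fun k => ?_
    have hexp : (R * adjoint R) ^ (k + 1) =
        ∑ i, (((R * adjoint R) ^ k) ∘L (R ∘L x i)) ∘L adjoint (y i) := by
      rw [pow_succ]
      generalize (R * adjoint R) ^ k = A
      rw [hadj, Finset.mul_sum, Finset.mul_sum]
      simp only [mul_def, comp_assoc]
    rw [hexp, Finset.sum_mul]
    refine norm_sum_le_of_le _ fun i _ => (opNorm_comp_le _ _).trans ?_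
    rw [LinearIsometryEquiv.norm_map]
    calc _ ≤ (c * c) ^ k * ‖R ∘L x i‖ * ‖y i‖ := by
          gcongr; exact hpow k _ (hR _ (hx i))
      _ = _ := by ring
  have hnorm : ‖R * adjoint R‖ = ‖R‖ * ‖R‖ := CStarRing.norm_self_mul_star
  rw [hnorm] at hle
  exact (mul_self_le_mul_self_iff (norm_nonneg R) hc0).2 hle

/-- If `P : T → X` is a contractive TRO conditional expectation onto a
sub-TRO `X ⊆ T`, then `‖∑ P(bᵢ) xᵢ*‖ ≤ ‖∑ bᵢ xᵢ*‖` for all `bᵢ ∈ T`, `xᵢ ∈ X`. -/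
theorem contractive_on_left_products
    (T X : Set (H →L[ℂ] K)) (P : (H →L[ℂ] K) → (H →L[ℂ] K))
    (hT : IsTRO T) (hX : IsSubTRO T X)
    (hP : IsTROCondExp T X P) (hPc : ContractiveOn T P)
    (n : ℕ) (b : Fin n → (H →L[ℂ] K)) (x : Fin n → (H →L[ℂ] K))
    (hb : ∀ i, b i ∈ T) (hx : ∀ i, x i ∈ X) :
    ‖∑ i, P (b i) ∘L ContinuousLinearMap.adjoint (x i)‖ ≤
      ‖∑ i, b i ∘L ContinuousLinearMap.adjoint (x i)‖ := by
  obtain ⟨hadd, hsmul, hPX, -, hmod, -, -⟩ := hP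
  obtain ⟨-, ⟨S, rfl⟩, hTtp⟩ := hT
  obtain ⟨hXT, -, ⟨Y, rfl⟩, hXtp⟩ := hX
  have hPsum : ∀ (s : Finset (Fin n)) (f : Fin n → H →L[ℂ] K), (∀ i, f i ∈ S) →
      P (∑ i ∈ s, f i) = ∑ i ∈ s, P (f i) := by
    intro s f hf
    induction s using Finset.cons_induction with
    | empty => simpa using hsmul 0 0 S.zero_mem
    | cons i s hi ih =>
      rw [Finset.sum_cons, Finset.sum_cons, ← ih]
      exact hadd _ (hf i) _ (S.sum_mem fun j _ => hf j)
  have hcomp : ∀ (u v : Fin n → H →L[ℂ] K) (z : H →L[ℂ] K),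
      (∑ i, u i ∘L adjoint (v i)) ∘L z = ∑ i, tp (u i) (v i) z := fun u v z => by
    rw [finsetSum_comp]; rfl
  have hadj : adjoint (∑ i, P (b i) ∘L adjoint (x i)) =
      ∑ i, x i ∘L adjoint (P (b i)) := by
    rw [map_sum]; simp [adjoint_comp]
  refine norm_sum_comp_adjoint_le hx rfl (norm_nonneg _) (fun z hz => ?_) (fun z hz => ?_)
    (fun z hz => ?_)
  · rw [hcomp]
    exact Y.sum_mem fun i _ => hXtp _ (hPX _ (hb i)) _ (hx i) _ hz
  · rw [hadj, hcomp]
    exact Y.sum_mem fun i _ => hXtp _ (hx i) _ (hPX _ (hb i)) _ hz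
  · have hmem : ∀ i, tp (b i) (x i) z ∈ S := fun i =>
      hTtp _ (hb i) _ (hXT (hx i)) _ (hXT hz)
    have hP_comp : (∑ i, P (b i) ∘L adjoint (x i)) ∘L z =
        P ((∑ i, b i ∘L adjoint (x i)) ∘L z) := by
      rw [hcomp, hcomp, hPsum _ _ hmem]
      exact Finset.sum_congr rfl fun i _ => (hmod _ (hb i) _ (hx i) _ hz).symm
    rw [hP_comp]
    refine (hPc _ ?_).trans (opNorm_comp_le _ _)
    rw [hcomp]
    exact S.sum_mem fun i _ => hmem i
end
end

section
/- Let T ⊆ B(H,K) be a TRO, X ⊆ T a nondegenerate sub-TRO, and P : T → X a contractive TRO conditional expectation onto X. Then there exists a unique contractive linear map Q : ⟨T T*⟩ → ⟨T T*⟩ such that Q(a x*) = P(a) x* for all a ∈ T, x ∈ X. Moreover Q is idempotent with range ⟨X X*⟩, satisfies Q(x a*) = x P(a)* for all a ∈ T, x ∈ X, and satisfies Q(c b) = Q(c) b and Q(b c) = b Q(c) for all c ∈ ⟨T T*⟩ and b ∈ ⟨X X*⟩; that is, Q is a conditional expectation from the C*-algebra ⟨T T*⟩ onto its C*-subalgebra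 ⟨X X*⟩. -/
noncomputable section

open ContinuousLinearMap

variable {H K : Type*} [NormedAddCommGroup H] [InnerProductSpace ℂ H] [CompleteSpace H]
  [NormedAddCommGroup K] [InnerProductSpace ℂ K] [CompleteSpace K]

/-- The defining properties of the left corner map `Q = P P† : ⟨T T*⟩ → ⟨T T*⟩`:
it maps `⟨T T*⟩` into itself, is linear and contractive on `⟨T T*⟩`
and satisfies `Q(a x*) = P(a) x*` for `a ∈ T`, `x ∈ X`. -/
def IsLeftCornerMap (T X : Set (H →L[ℂ] K))
    (P : (H →L[ℂ] K) → (H →L[ℂ] K)) (Q : (K →L[ℂ] K) → (K →L[ℂ] K)) : Prop :=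
  (∀ c ∈ cspan (setMulStar T T), Q c ∈ cspan (setMulStar T T)) ∧
  (∀ c ∈ cspan (setMulStar T T), ∀ d ∈ cspan (setMulStar T T), Q (c + d) = Q c + Q d) ∧
  (∀ (z : ℂ), ∀ c ∈ cspan (setMulStar T T), Q (z • c) = z • Q c) ∧
  (∀ c ∈ cspan (setMulStar T T), ‖Q c‖ ≤ ‖c‖) ∧
  (∀ a ∈ T, ∀ x ∈ X,
    Q (a ∘L ContinuousLinearMap.adjoint x) = P a ∘L ContinuousLinearMap.adjoint x)

/-- The defining properties of the right corner map `Q' = P† P : ⟨T* T⟩ → ⟨T* T⟩`: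
it maps `⟨T* T⟩` into itself, is linear and contractive on `⟨T* T⟩`
and satisfies `Q'(x* a) = x* P(a)` for `a ∈ T`, `x ∈ X`. -/
def IsRightCornerMap (T X : Set (H →L[ℂ] K))
    (P : (H →L[ℂ] K) → (H →L[ℂ] K)) (Q' : (H →L[ℂ] H) → (H →L[ℂ] H)) : Prop :=
  (∀ d ∈ cspan (setStarMul T T), Q' d ∈ cspan (setStarMul T T)) ∧
  (∀ c ∈ cspan (setStarMul T T), ∀ d ∈ cspan (setStarMul T T), Q' (c + d) = Q' c + Q' d) ∧
  (∀ (z : ℂ), ∀ d ∈ cspan (setStarMul T T), Q' (z • d) = z • Q' d) ∧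
  (∀ d ∈ cspan (setStarMul T T), ‖Q' d‖ ≤ ‖d‖) ∧
  (∀ a ∈ T, ∀ x ∈ X,
    Q' (ContinuousLinearMap.adjoint x ∘L a) = ContinuousLinearMap.adjoint x ∘L P a)

/-- The closed linear span, as a submodule. -/
def cspanSubmodule {V : Type*} [NormedAddCommGroup V] [NormedSpace ℂ V] (S : Set V) :
    Submodule ℂ V :=
  (Submodule.span ℂ S).topologicalClosure

theorem mem_cspanSubmodule {V : Type*} [NormedAddCommGroup V] [NormedSpace ℂ V] {S : Set V}
    {v : V} : v ∈ cspanSubmodule S ↔ v ∈ cspan S :=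
  Iff.rfl

theorem isClosed_cspan {V : Type*} [NormedAddCommGroup V] [NormedSpace ℂ V] (S : Set V) :
    IsClosed (cspan S) :=
  isClosed_closure

theorem subset_cspan {V : Type*} [NormedAddCommGroup V] [NormedSpace ℂ V] (S : Set V) :
    S ⊆ cspan S :=
  Submodule.subset_span.trans subset_closure

theorem cspan_subset {V : Type*} [NormedAddCommGroup V] [NormedSpace ℂ V] {S : Set V}
    {M : Submodule ℂ V} (hM : IsClosed (M : Set V)) (h : S ⊆ M) : cspan S ⊆ M :=
  closure_minimal (Submodule.span_le.2 h) hM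

/-- A continuous semilinear map sending `S` into a closed subspace sends `⟨S⟩` into it. -/
theorem map_mem_of_mem_cspan {V W : Type*} [NormedAddCommGroup V] [NormedSpace ℂ V]
    [NormedAddCommGroup W] [NormedSpace ℂ W] {σ : ℂ →+* ℂ} (L : V →SL[σ] W) {S : Set V}
    {M : Submodule ℂ W} (hM : IsClosed (M : Set W)) (h : ∀ v ∈ S, L v ∈ M) {v : V}
    (hv : v ∈ cspan S) : L v ∈ M :=
  cspan_subset (M := M.comap (L : V →ₛₗ[σ] W)) (hM.preimage L.continuous) h hv

theorem setMulStar_mono {S₁ S₂ T₁ T₂ : Set (H →L[ℂ] K)} (hS : S₁ ⊆ S₂) (hT : T₁ ⊆ T₂) :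
    setMulStar S₁ T₁ ⊆ setMulStar S₂ T₂ := by
  rintro _ ⟨a, ha, b, hb, rfl⟩
  exact ⟨a, hS ha, b, hT hb, rfl⟩

theorem cspan_setMulStar_mono {S₁ S₂ T₁ T₂ : Set (H →L[ℂ] K)} (hS : S₁ ⊆ S₂) (hT : T₁ ⊆ T₂) :
    cspan (setMulStar S₁ T₁) ⊆ cspan (setMulStar S₂ T₂) :=
  closure_mono (Submodule.span_mono (setMulStar_mono hS hT))

theorem comp_adjoint_mem_cspan {S T : Set (H →L[ℂ] K)} {a b : H →L[ℂ] K} (ha : a ∈ S)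
    (hb : b ∈ T) : a ∘L adjoint b ∈ cspan (setMulStar S T) :=
  subset_cspan _ ⟨a, ha, b, hb, rfl⟩

theorem IsSubTRO.isTRO {T X : Set (H →L[ℂ] K)} (hX : IsSubTRO T X) : IsTRO X :=
  hX.2

/-- `⟨T T*⟩ T ⊆ T`. -/
theorem IsTRO.comp_mem {T : Set (H →L[ℂ] K)} (hT : IsTRO T) {c : K →L[ℂ] K}
    (hc : c ∈ cspan (setMulStar T T)) {t : H →L[ℂ] K} (ht : t ∈ T) : c ∘L t ∈ T := by
  obtain ⟨hcl, ⟨S, rfl⟩, htp⟩ := hT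
  refine map_mem_of_mem_cspan ((compL ℂ H K K).flip t) hcl ?_ hc
  rintro _ ⟨a, ha, b, hb, rfl⟩
  exact htp a ha b hb t ht

/-- `⟨T T*⟩` is closed under multiplication. -/
theorem IsTRO.comp_mem_cspan {T : Set (H →L[ℂ] K)} (hT : IsTRO T) {c d : K →L[ℂ] K}
    (hc : c ∈ cspan (setMulStar T T)) (hd : d ∈ cspan (setMulStar T T)) :
    c ∘L d ∈ cspan (setMulStar T T) := by
  refine map_mem_of_mem_cspan (M := cspanSubmodule (setMulStar T T)) (compL ℂ K K K c)
    (isClosed_cspan _) ?_ hd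
  rintro _ ⟨a, ha, b, hb, rfl⟩
  exact comp_adjoint_mem_cspan (hT.comp_mem hc ha) hb

/-- `⟨T T*⟩` is closed under adjoints. -/
theorem adjoint_mem_cspan {T : Set (H →L[ℂ] K)} {c : K →L[ℂ] K}
    (hc : c ∈ cspan (setMulStar T T)) : adjoint c ∈ cspan (setMulStar T T) := by
  refine map_mem_of_mem_cspan (M := cspanSubmodule (setMulStar T T))
    ((adjoint : (K →L[ℂ] K) ≃ₗᵢ⋆[ℂ] (K →L[ℂ] K)).toContinuousLinearEquiv.toContinuousLinearMap)
    (isClosed_cspan _) ?_ hc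
  rintro _ ⟨a, ha, b, hb, rfl⟩
  have := comp_adjoint_mem_cspan hb ha
  simpa [adjoint_comp, mem_cspanSubmodule] using this

/-- Nondegeneracy gives `⟨T T*⟩ ⊆ ⟨T X*⟩`. -/
theorem Nondegenerate.cspan_subset {T X : Set (H →L[ℂ] K)} (hT : IsTRO T)
    (hXnd : Nondegenerate T X) : cspan (setMulStar T T) ⊆ cspan (setMulStar T X) := by
  refine _root_.cspan_subset (M := cspanSubmodule (setMulStar T X)) (isClosed_cspan _) ?_
  rintro _ ⟨a, ha, t, ht, rfl⟩
  rw [← hXnd.1] at ht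
  refine map_mem_of_mem_cspan (M := cspanSubmodule (setMulStar T X))
    ((compL ℂ K H K a).comp
      (adjoint : (H →L[ℂ] K) ≃ₗᵢ⋆[ℂ] _).toContinuousLinearEquiv.toContinuousLinearMap)
    (isClosed_cspan _) ?_ ht
  rintro _ ⟨x, hx, b, hb, c, hc, rfl⟩
  have := comp_adjoint_mem_cspan (hT.2.2 a ha c hc b hb) hx
  simpa [mem_cspanSubmodule, tp, adjoint_comp, ContinuousLinearMap.comp_assoc] using this

theorem le_of_forall_pow_le_mul_pow {s r C : ℝ} (hr : 0 ≤ r)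
    (h : ∀ n : ℕ, s ^ n ≤ C * r ^ n) : s ≤ r := by
  by_contra! hlt
  have hs : 0 < s := hr.trans_lt hlt
  have hC : 0 < C := by have := h 0; simp at this; linarith
  obtain ⟨n, hn⟩ := exists_pow_lt_of_lt_one (inv_pos.2 hC) ((div_lt_one hs).2 hlt)
  have h1 := h n
  rw [div_pow, div_lt_iff₀ (pow_pos hs n), inv_mul_eq_div, lt_div_iff₀ hC] at hn
  linarith

theorem IsSelfAdjoint.norm_pow_succ {E : Type*} [NormedRing E] [StarRing E] [CStarRing E]
    {h : E} (hh : IsSelfAdjoint h) (n : ℕ) :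
    ‖h ^ (n + 1)‖ = ‖h‖ ^ (n + 1) := by
  refine le_antisymm (norm_pow_le' h n.succ_pos) ?_
  rcases (norm_nonneg h).eq_or_lt with h0 | h0
  · rw [← h0, zero_pow n.succ_ne_zero]
    positivity
  have hn : n + 1 + (2 ^ (n + 1) - (n + 1)) = 2 ^ (n + 1) :=
    Nat.add_sub_cancel' Nat.lt_two_pow_self.le
  have hpos : 0 < 2 ^ (n + 1) - (n + 1) := Nat.sub_pos_of_lt Nat.lt_two_pow_self
  refine le_of_mul_le_mul_right ?_ (pow_pos h0 (2 ^ (n + 1) - (n + 1)))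
  calc ‖h‖ ^ (n + 1) * ‖h‖ ^ (2 ^ (n + 1) - (n + 1)) = ‖h ^ 2 ^ (n + 1)‖ := by
        rw [← pow_add, hn, hh.norm_pow_two_pow]
    _ = ‖h ^ (n + 1) * h ^ (2 ^ (n + 1) - (n + 1))‖ := by rw [← pow_add, hn]
    _ ≤ ‖h ^ (n + 1)‖ * ‖h ^ (2 ^ (n + 1) - (n + 1))‖ := norm_mul_le _ _
    _ ≤ ‖h ^ (n + 1)‖ * ‖h‖ ^ (2 ^ (n + 1) - (n + 1)) := by
        gcongr
        exact norm_pow_le' h hpos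

/-- If `h` acts on `X` with norm at most `r`, the products `hⁿ g` with `g` in the linear span of
`X X*` grow at most like `rⁿ`. -/
theorem exists_norm_pow_mul_le {X : Set (H →L[ℂ] K)} {h : K →L[ℂ] K}
    (hmem : ∀ y ∈ X, h ∘L y ∈ X) {r : ℝ} (hr : 0 ≤ r) (hb : ∀ y ∈ X, ‖h ∘L y‖ ≤ r * ‖y‖)
    {g : K →L[ℂ] K} (hg : g ∈ Submodule.span ℂ (setMulStar X X)) :
    ∃ C : ℝ, ∀ n : ℕ, ‖h ^ n * g‖ ≤ C * r ^ n := by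
  induction hg using Submodule.span_induction with
  | mem g hg =>
    obtain ⟨a, ha, b, -, rfl⟩ := hg
    refine ⟨‖a‖ * ‖adjoint b‖, fun n => ?_⟩
    have key : (h ^ n) ∘L a ∈ X ∧ ‖(h ^ n) ∘L a‖ ≤ r ^ n * ‖a‖ := by
      induction n with
      | zero => exact ⟨by simpa [one_def] using ha, by simp [one_def]⟩
      | succ n ih =>
        have e : (h ^ (n + 1)) ∘L a = h ∘L ((h ^ n) ∘L a) := by
          rw [pow_succ', mul_def, ContinuousLinearMap.comp_assoc]
        rw [e]
        refine ⟨hmem _ ih.1, (hb _ ih.1).trans ?_⟩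
        rw [pow_succ', mul_assoc]
        exact mul_le_mul_of_nonneg_left ih.2 hr
    calc ‖h ^ n * (a ∘L adjoint b)‖ = ‖((h ^ n) ∘L a) ∘L adjoint b‖ := by
          rw [mul_def, ContinuousLinearMap.comp_assoc]
      _ ≤ ‖(h ^ n) ∘L a‖ * ‖adjoint b‖ := opNorm_comp_le _ _
      _ ≤ (r ^ n * ‖a‖) * ‖adjoint b‖ := by gcongr; exact key.2
      _ = ‖a‖ * ‖adjoint b‖ * r ^ n := by ring
  | zero => exact ⟨0, by simp⟩
  | add g₁ g₂ _ _ ih₁ ih₂ =>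
    obtain ⟨C₁, h₁⟩ := ih₁
    obtain ⟨C₂, h₂⟩ := ih₂
    refine ⟨C₁ + C₂, fun n => ?_⟩
    rw [mul_add, add_mul]
    exact (norm_add_le _ _).trans (add_le_add (h₁ n) (h₂ n))
  | smul z g _ ih =>
    obtain ⟨C, hC⟩ := ih
    refine ⟨‖z‖ * C, fun n => ?_⟩
    rw [mul_smul_comm, norm_smul, mul_assoc]
    gcongr
    exact hC n

/-- The norm of an element of `⟨X X*⟩` is determined by left multiplication on `X`. -/
theorem IsTRO.norm_le_of_forall_comp {X : Set (H →L[ℂ] K)} (hX : IsTRO X) {w : K →L[ℂ] K}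
    (hw : w ∈ cspan (setMulStar X X)) {M : ℝ} (hM : 0 ≤ M)
    (h : ∀ y ∈ X, ‖w ∘L y‖ ≤ M * ‖y‖) : ‖w‖ ≤ M := by
  rcases (norm_nonneg w).eq_or_lt with h0 | h0
  · rwa [← h0]
  set k : K →L[ℂ] K := adjoint w ∘L w with hk
  have hkn : ‖k‖ = ‖w‖ * ‖w‖ := norm_adjoint_comp_self w
  have hkpos : 0 < ‖k‖ := by rw [hkn]; positivity
  have hkA : k ∈ cspan (setMulStar X X) := hX.comp_mem_cspan (adjoint_mem_cspan hw) hw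
  have hksa : IsSelfAdjoint k := IsSelfAdjoint.star_mul_self w
  have hr : 0 ≤ ‖w‖ * M := by positivity
  have hkb : ∀ y ∈ X, ‖k ∘L y‖ ≤ ‖w‖ * M * ‖y‖ := fun y hy => by
    calc ‖k ∘L y‖ = ‖adjoint w ∘L (w ∘L y)‖ := by rw [hk, ContinuousLinearMap.comp_assoc]
      _ ≤ ‖adjoint w‖ * ‖w ∘L y‖ := opNorm_comp_le _ _
      _ ≤ ‖w‖ * (M * ‖y‖) := by
          rw [LinearIsometryEquiv.norm_map]
          exact mul_le_mul_of_nonneg_left (h y hy) h0.le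
      _ = ‖w‖ * M * ‖y‖ := by ring
  obtain ⟨g, hg, hgk⟩ := Metric.mem_closure_iff.1 hkA (‖k‖ / 2) (by positivity)
  rw [dist_eq_norm] at hgk
  obtain ⟨C, hC⟩ := exists_norm_pow_mul_le (fun y hy => hX.comp_mem hkA hy) hr hkb hg
  have hle : ‖k‖ ≤ ‖w‖ * M := by
    refine le_of_forall_pow_le_mul_pow (C := 2 * C / ‖k‖) hr fun n => ?_
    have hsplit : ‖k‖ ^ (n + 1) ≤ C * (‖w‖ * M) ^ n + ‖k‖ ^ n * (‖k‖ / 2) := by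
      calc ‖k‖ ^ (n + 1) = ‖k ^ n * g + k ^ n * (k - g)‖ := by
            rw [← hksa.norm_pow_succ, ← mul_add, add_sub_cancel, pow_succ]
        _ ≤ ‖k ^ n * g‖ + ‖k ^ n * (k - g)‖ := norm_add_le _ _
        _ ≤ C * (‖w‖ * M) ^ n + ‖k‖ ^ n * (‖k‖ / 2) := by
            refine add_le_add (hC n) ?_
            rcases n.eq_zero_or_pos with rfl | hn
            · simpa using hgk.le
            · exact (norm_mul_le _ _).trans (mul_le_mul (norm_pow_le' k hn) hgk.le
                (norm_nonneg _) (by positivity))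
    rw [div_mul_eq_mul_div, le_div_iff₀ hkpos]
    rw [pow_succ] at hsplit
    linarith
  rw [hkn] at hle
  exact le_of_mul_le_mul_left hle h0

section CondExp

variable {T X : Set (H →L[ℂ] K)} {P : (H →L[ℂ] K) → (H →L[ℂ] K)}

theorem IsTROCondExp.map_sub (hP : IsTROCondExp T X P) (hT : IsTRO T) {s t : H →L[ℂ] K}
    (hs : s ∈ T) (ht : t ∈ T) : P (s - t) = P s - P t := by
  obtain ⟨-, ⟨S, rfl⟩, -⟩ := hT
  have h := hP.1 _ (S.sub_mem hs ht) _ ht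
  rw [sub_add_cancel] at h
  exact eq_sub_of_add_eq h.symm

theorem IsTROCondExp.continuousOn (hP : IsTROCondExp T X P) (hT : IsTRO T)
    (hPc : ContractiveOn T P) : ContinuousOn P T := by
  refine (LipschitzOnWith.of_dist_le_mul (K := 1) fun s hs t ht => ?_).continuousOn
  rw [dist_eq_norm, dist_eq_norm, ← hP.map_sub hT hs ht, NNReal.coe_one, one_mul]
  obtain ⟨-, ⟨S, rfl⟩, -⟩ := hT
  exact hPc _ (S.sub_mem hs ht)

/-- `P` is a left `⟨X X*⟩`-module map. -/
theorem IsTROCondExp.map_comp (hP : IsTROCondExp T X P) (hT : IsTRO T) (hX : IsSubTRO T X)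
    (hPc : ContractiveOn T P) {b : K →L[ℂ] K} (hb : b ∈ cspan (setMulStar X X))
    {a : H →L[ℂ] K} (ha : a ∈ T) : P (b ∘L a) = b ∘L P a := by
  have hXT := cspan_setMulStar_mono hX.1 hX.1
  have hmem : ∀ c ∈ cspan (setMulStar X X), c ∘L a ∈ T := fun c hc => hT.comp_mem (hXT hc) ha
  let M : Submodule ℂ (K →L[ℂ] K) :=
    { carrier := cspan (setMulStar X X) ∩ (fun c => P (c ∘L a) - c ∘L P a) ⁻¹' {0}
      zero_mem' := by
        refine ⟨(cspanSubmodule (setMulStar X X)).zero_mem, ?_⟩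
        have h0 : P 0 = 0 := by simpa using hP.2.1 0 a ha
        simp [h0]
      add_mem' := by
        rintro c d ⟨hc, hc'⟩ ⟨hd, hd'⟩
        refine ⟨(cspanSubmodule (setMulStar X X)).add_mem hc hd, ?_⟩
        simp only [Set.mem_preimage, Set.mem_singleton_iff, sub_eq_zero] at hc' hd' ⊢
        rw [add_comp, hP.1 _ (hmem c hc) _ (hmem d hd), hc', hd', add_comp]
      smul_mem' := by
        rintro z c ⟨hc, hc'⟩
        refine ⟨(cspanSubmodule (setMulStar X X)).smul_mem z hc, ?_⟩
        simp only [Set.mem_preimage, Set.mem_singleton_iff, sub_eq_zero] at hc' ⊢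
        rw [smul_comp, hP.2.1 _ _ (hmem c hc), hc', smul_comp] }
  have hM : IsClosed (M : Set (K →L[ℂ] K)) := by
    refine ContinuousOn.preimage_isClosed_of_isClosed (ContinuousOn.sub ?_ ?_)
      (isClosed_cspan _) isClosed_singleton
    · exact (hP.continuousOn hT hPc).comp
        ((compL ℂ H K K).flip a).continuous.continuousOn hmem
    · exact ((compL ℂ H K K).flip (P a)).continuous.continuousOn
  have hsub : cspan (setMulStar X X) ⊆ M := by
    refine cspan_subset hM ?_
    rintro _ ⟨x, hx, y, hy, rfl⟩
    exact ⟨comp_adjoint_mem_cspan hx hy, sub_eq_zero.2 (hP.2.2.2.2.2.2 a ha x hx y hy)⟩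
  exact sub_eq_zero.1 (hsub hb).2

/-- The relation between `c ∈ ⟨T T*⟩` and `d ∈ ⟨X X*⟩` expressing that `d` compresses `c`:
`d y = P (c y)` for all `y ∈ X`. It is the graph of the left corner map. -/
def IsCornerPair (T X : Set (H →L[ℂ] K)) (P : (H →L[ℂ] K) → (H →L[ℂ] K))
    (c d : K →L[ℂ] K) : Prop :=
  c ∈ cspan (setMulStar T T) ∧ d ∈ cspan (setMulStar X X) ∧ ∀ y ∈ X, d ∘L y = P (c ∘L y)

theorem IsCornerPair.add (hP : IsTROCondExp T X P) (hT : IsTRO T) (hX : IsSubTRO T X)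
    {c d c' d' : K →L[ℂ] K} (h : IsCornerPair T X P c d) (h' : IsCornerPair T X P c' d') :
    IsCornerPair T X P (c + c') (d + d') := by
  refine ⟨(cspanSubmodule _).add_mem h.1 h'.1, (cspanSubmodule _).add_mem h.2.1 h'.2.1,
    fun y hy => ?_⟩
  rw [add_comp, add_comp, h.2.2 y hy, h'.2.2 y hy,
    hP.1 _ (hT.comp_mem h.1 (hX.1 hy)) _ (hT.comp_mem h'.1 (hX.1 hy))]

theorem IsCornerPair.smul (hP : IsTROCondExp T X P) (hT : IsTRO T) (hX : IsSubTRO T X)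
    (z : ℂ) {c d : K →L[ℂ] K} (h : IsCornerPair T X P c d) :
    IsCornerPair T X P (z • c) (z • d) := by
  refine ⟨(cspanSubmodule _).smul_mem z h.1, (cspanSubmodule _).smul_mem z h.2.1,
    fun y hy => ?_⟩
  rw [smul_comp, smul_comp, h.2.2 y hy, hP.2.1 _ _ (hT.comp_mem h.1 (hX.1 hy))]

theorem IsCornerPair.norm_le (hPc : ContractiveOn T P) (hT : IsTRO T) (hX : IsSubTRO T X)
    {c d : K →L[ℂ] K} (h : IsCornerPair T X P c d) : ‖d‖ ≤ ‖c‖ := by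
  refine hX.isTRO.norm_le_of_forall_comp h.2.1 (norm_nonneg c) fun y hy => ?_
  rw [h.2.2 y hy]
  exact (hPc _ (hT.comp_mem h.1 (hX.1 hy))).trans (opNorm_comp_le _ _)

theorem IsCornerPair.unique (hX : IsSubTRO T X)
    {c d d' : K →L[ℂ] K} (h : IsCornerPair T X P c d) (h' : IsCornerPair T X P c d') :
    d = d' := by
  refine sub_eq_zero.1 (norm_le_zero_iff.1 ?_)
  refine hX.isTRO.norm_le_of_forall_comp ((cspanSubmodule _).sub_mem h.2.1 h'.2.1) le_rfl
    fun y hy => ?_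
  rw [sub_comp, h.2.2 y hy, h'.2.2 y hy, sub_self, norm_zero, zero_mul]

theorem isCornerPair_comp_adjoint (hP : IsTROCondExp T X P) (hX : IsSubTRO T X)
    {a x : H →L[ℂ] K} (ha : a ∈ T) (hx : x ∈ X) :
    IsCornerPair T X P (a ∘L adjoint x) (P a ∘L adjoint x) :=
  ⟨comp_adjoint_mem_cspan ha (hX.1 hx), comp_adjoint_mem_cspan (hP.2.2.1 a ha) hx,
    fun y hy => (hP.2.2.2.2.1 a ha x hx y hy).symm⟩

theorem isCornerPair_adjoint_comp (hP : IsTROCondExp T X P) (hX : IsSubTRO T X)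
    {a x : H →L[ℂ] K} (ha : a ∈ T) (hx : x ∈ X) :
    IsCornerPair T X P (x ∘L adjoint a) (x ∘L adjoint (P a)) :=
  ⟨comp_adjoint_mem_cspan (hX.1 hx) ha, comp_adjoint_mem_cspan hx (hP.2.2.1 a ha),
    fun y hy => (hP.2.2.2.2.2.1 a ha x hx y hy).symm⟩

theorem isCornerPair_self (hP : IsTROCondExp T X P) (hX : IsSubTRO T X) {b : K →L[ℂ] K}
    (hb : b ∈ cspan (setMulStar X X)) : IsCornerPair T X P b b :=
  ⟨cspan_setMulStar_mono hX.1 hX.1 hb, hb,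
    fun _ hy => (hP.2.2.2.1 _ (hX.isTRO.comp_mem hb hy)).symm⟩

theorem IsCornerPair.comp_right (hT : IsTRO T) (hX : IsSubTRO T X) {b c d : K →L[ℂ] K}
    (h : IsCornerPair T X P c d) (hb : b ∈ cspan (setMulStar X X)) :
    IsCornerPair T X P (c ∘L b) (d ∘L b) :=
  ⟨hT.comp_mem_cspan h.1 (cspan_setMulStar_mono hX.1 hX.1 hb), hX.isTRO.comp_mem_cspan h.2.1 hb,
    fun _ hy => h.2.2 _ (hX.isTRO.comp_mem hb hy)⟩

theorem IsCornerPair.comp_left (hP : IsTROCondExp T X P) (hPc : ContractiveOn T P)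
    (hT : IsTRO T) (hX : IsSubTRO T X) {b c d : K →L[ℂ] K}
    (h : IsCornerPair T X P c d) (hb : b ∈ cspan (setMulStar X X)) :
    IsCornerPair T X P (b ∘L c) (b ∘L d) := by
  refine ⟨hT.comp_mem_cspan (cspan_setMulStar_mono hX.1 hX.1 hb) h.1,
    hX.isTRO.comp_mem_cspan hb h.2.1, fun y hy => ?_⟩
  rw [ContinuousLinearMap.comp_assoc, h.2.2 y hy, ContinuousLinearMap.comp_assoc,
    hP.map_comp hT hX hPc hb (hT.comp_mem h.1 (hX.1 hy))]

theorem isClosed_setOf_isCornerPair (hP : IsTROCondExp T X P) (hPc : ContractiveOn T P)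
    (hT : IsTRO T) (hX : IsSubTRO T X) :
    IsClosed {p : (K →L[ℂ] K) × (K →L[ℂ] K) | IsCornerPair T X P p.1 p.2} := by
  have hprod : IsClosed (cspan (setMulStar T T) ×ˢ cspan (setMulStar X X)) :=
    (isClosed_cspan _).prod (isClosed_cspan _)
  have heq : {p : (K →L[ℂ] K) × (K →L[ℂ] K) | IsCornerPair T X P p.1 p.2} =
      (cspan (setMulStar T T) ×ˢ cspan (setMulStar X X)) ∩ ⋂ y ∈ X,
        ((cspan (setMulStar T T) ×ˢ cspan (setMulStar X X)) ∩
          (fun p : (K →L[ℂ] K) × (K →L[ℂ] K) => p.2 ∘L y - P (p.1 ∘L y)) ⁻¹' {0}) := by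
    ext p
    simp only [IsCornerPair, Set.mem_ofPred_eq, Set.mem_inter_iff, Set.mem_prod, Set.mem_iInter,
      Set.mem_preimage, Set.mem_singleton_iff, sub_eq_zero]
    exact ⟨fun h => ⟨⟨h.1, h.2.1⟩, fun y hy => ⟨⟨h.1, h.2.1⟩, h.2.2 y hy⟩⟩,
      fun h => ⟨h.1.1, h.1.2, fun y hy => (h.2 y hy).2⟩⟩
  rw [heq]
  refine hprod.inter (isClosed_biInter fun y hy => ?_)
  refine ContinuousOn.preimage_isClosed_of_isClosed (ContinuousOn.sub ?_ ?_) hprod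
    isClosed_singleton
  · exact (((compL ℂ H K K).flip y).continuous.comp continuous_snd).continuousOn
  · exact (hP.continuousOn hT hPc).comp
      (((compL ℂ H K K).flip y).continuous.comp continuous_fst).continuousOn
      fun p hp => hT.comp_mem hp.1 (hX.1 hy)

theorem exists_isCornerPair (hP : IsTROCondExp T X P) (hPc : ContractiveOn T P)
    (hT : IsTRO T) (hX : IsSubTRO T X) (hXnd : Nondegenerate T X) {c : K →L[ℂ] K}
    (hc : c ∈ cspan (setMulStar T T)) : ∃ d, IsCornerPair T X P c d := by
  let G : Submodule ℂ ((K →L[ℂ] K) × (K →L[ℂ] K)) :=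
    { carrier := {p | IsCornerPair T X P p.1 p.2}
      zero_mem' := isCornerPair_self hP hX (cspanSubmodule (setMulStar X X)).zero_mem
      add_mem' := fun h h' => IsCornerPair.add hP hT hX h h'
      smul_mem' := fun z _ h => IsCornerPair.smul hP hT hX z h }
  have hG : IsClosed (G : Set ((K →L[ℂ] K) × (K →L[ℂ] K))) :=
    isClosed_setOf_isCornerPair hP hPc hT hX
  have : CompleteSpace G := hG.completeSpace_coe
  let π : G →ₗ[ℂ] (K →L[ℂ] K) := (LinearMap.fst ℂ _ _).comp G.subtype
  have hπ : Isometry π := AddMonoidHomClass.isometry_of_norm π fun p =>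
    (max_eq_left (IsCornerPair.norm_le hPc hT hX p.2)).symm
  have hcl : IsClosed (LinearMap.range π : Set (K →L[ℂ] K)) := by
    rw [LinearMap.coe_range]
    exact hπ.isClosedEmbedding.isClosed_range
  have hsub : cspan (setMulStar T X) ⊆ LinearMap.range π := by
    refine cspan_subset hcl ?_
    rintro _ ⟨a, ha, x, hx, rfl⟩
    exact ⟨⟨(_, _), isCornerPair_comp_adjoint hP hX ha hx⟩, rfl⟩
  obtain ⟨p, rfl⟩ := hsub (hXnd.cspan_subset hT hc)
  exact ⟨_, p.2⟩

end CondExp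

/-- Left corner maps are determined by their values on `T X*`. -/
theorem IsLeftCornerMap.eq {T X : Set (H →L[ℂ] K)} {P : (H →L[ℂ] K) → (H →L[ℂ] K)}
    {Q₁ Q₂ : (K →L[ℂ] K) → (K →L[ℂ] K)} (hT : IsTRO T) (hX : IsSubTRO T X)
    (hXnd : Nondegenerate T X) (h₁ : IsLeftCornerMap T X P Q₁) (h₂ : IsLeftCornerMap T X P Q₂)
    {c : K →L[ℂ] K} (hc : c ∈ cspan (setMulStar T T)) : Q₁ c = Q₂ c := by
  let C := cspanSubmodule (setMulStar T T)
  have hcont : ∀ {Q}, IsLeftCornerMap T X P Q → ContinuousOn Q (C : Set (K →L[ℂ] K)) := by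
    intro Q hQ
    refine (LipschitzOnWith.of_dist_le_mul (K := 1) fun s hs t ht => ?_).continuousOn
    have h := hQ.2.1 _ (C.sub_mem hs ht) _ ht
    rw [sub_add_cancel] at h
    rw [dist_eq_norm, dist_eq_norm, h, add_sub_cancel_right, NNReal.coe_one, one_mul]
    exact hQ.2.2.2.1 _ (C.sub_mem hs ht)
  let M : Submodule ℂ (K →L[ℂ] K) :=
    { carrier := C ∩ (fun c => Q₁ c - Q₂ c) ⁻¹' {0}
      zero_mem' := by
        refine ⟨C.zero_mem, ?_⟩
        have e₁ := h₁.2.2.1 0 0 C.zero_mem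
        have e₂ := h₂.2.2.1 0 0 C.zero_mem
        rw [zero_smul, zero_smul] at e₁ e₂
        simp [e₁, e₂]
      add_mem' := by
        rintro c d ⟨hc, hc'⟩ ⟨hd, hd'⟩
        refine ⟨C.add_mem hc hd, ?_⟩
        simp only [Set.mem_preimage, Set.mem_singleton_iff, sub_eq_zero] at hc' hd' ⊢
        rw [h₁.2.1 c hc d hd, h₂.2.1 c hc d hd, hc', hd']
      smul_mem' := by
        rintro z c ⟨hc, hc'⟩
        refine ⟨C.smul_mem z hc, ?_⟩
        simp only [Set.mem_preimage, Set.mem_singleton_iff, sub_eq_zero] at hc' ⊢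
        rw [h₁.2.2.1 z c hc, h₂.2.2.1 z c hc, hc'] }
  have hM : IsClosed (M : Set (K →L[ℂ] K)) :=
    ContinuousOn.preimage_isClosed_of_isClosed ((hcont h₁).sub (hcont h₂))
      (isClosed_cspan _) isClosed_singleton
  have hsub : cspan (setMulStar T X) ⊆ M := by
    refine cspan_subset hM ?_
    rintro _ ⟨a, ha, x, hx, rfl⟩
    refine ⟨comp_adjoint_mem_cspan ha (hX.1 hx), sub_eq_zero.2 ?_⟩
    rw [h₁.2.2.2.2 a ha x hx, h₂.2.2.2.2 a ha x hx]
  exact sub_eq_zero.1 (hsub (hXnd.cspan_subset hT hc)).2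

/-- Existence and uniqueness of the conditional expectation
`Q = P P† : ⟨T T*⟩ → ⟨X X*⟩`. -/
theorem exists_unique_left_corner_map
    (T X : Set (H →L[ℂ] K)) (P : (H →L[ℂ] K) → (H →L[ℂ] K))
    (hT : IsTRO T) (hX : IsSubTRO T X) (hXnd : Nondegenerate T X)
    (hP : IsTROCondExp T X P) (hPc : ContractiveOn T P) :
    ∃ Q : (K →L[ℂ] K) → (K →L[ℂ] K), IsLeftCornerMap T X P Q ∧
      -- uniqueness: any map with these properties agrees with `Q` on `⟨T T*⟩`
      (∀ Q₂, IsLeftCornerMap T X P Q₂ → ∀ c ∈ cspan (setMulStar T T), Q₂ c = Q c) ∧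
      -- `Q` is idempotent
      (∀ c ∈ cspan (setMulStar T T), Q (Q c) = Q c) ∧
      -- the range of `Q` is `⟨X X*⟩`
      (∀ c ∈ cspan (setMulStar T T), Q c ∈ cspan (setMulStar X X)) ∧
      (∀ b ∈ cspan (setMulStar X X), Q b = b) ∧
      -- `Q (x a*) = x P(a)*`
      (∀ a ∈ T, ∀ x ∈ X, Q (x ∘L ContinuousLinearMap.adjoint a)
          = x ∘L ContinuousLinearMap.adjoint (P a)) ∧
      -- `Q` is a `⟨X X*⟩`-bimodule map, i.e. a conditional expectation onto `⟨X X*⟩`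
      (∀ c ∈ cspan (setMulStar T T), ∀ b ∈ cspan (setMulStar X X),
          Q (c ∘L b) = Q c ∘L b ∧ Q (b ∘L c) = b ∘L Q c) := by
  have hex : ∀ c, ∃ d, c ∈ cspan (setMulStar T T) → IsCornerPair T X P c d := fun c => by
    by_cases hc : c ∈ cspan (setMulStar T T)
    · obtain ⟨d, hd⟩ := exists_isCornerPair hP hPc hT hX hXnd hc
      exact ⟨d, fun _ => hd⟩
    · exact ⟨0, fun h => absurd h hc⟩
  choose Q hQ using hex
  have hQeq : ∀ {c d}, IsCornerPair T X P c d → Q c = d := fun h => (hQ _ h.1).unique hX h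
  have hQmem : ∀ c ∈ cspan (setMulStar T T), Q c ∈ cspan (setMulStar X X) :=
    fun c hc => (hQ c hc).2.1
  have hQfix : ∀ b ∈ cspan (setMulStar X X), Q b = b :=
    fun b hb => hQeq (isCornerPair_self hP hX hb)
  have hQcorner : IsLeftCornerMap T X P Q :=
    ⟨fun c hc => cspan_setMulStar_mono hX.1 hX.1 (hQmem c hc),
      fun c hc d hd => hQeq ((hQ c hc).add hP hT hX (hQ d hd)),
      fun z c hc => hQeq ((hQ c hc).smul hP hT hX z),
      fun c hc => (hQ c hc).norm_le hPc hT hX,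
      fun a ha x hx => hQeq (isCornerPair_comp_adjoint hP hX ha hx)⟩
  exact ⟨Q, hQcorner, fun Q₂ hQ₂ c hc => hQ₂.eq hT hX hXnd hQcorner hc,
    fun c hc => hQfix _ (hQmem c hc), hQmem, hQfix,
    fun a ha x hx => hQeq (isCornerPair_adjoint_comp hP hX ha hx),
    fun c hc b hb => ⟨hQeq ((hQ c hc).comp_right hT hX hb),
      hQeq ((hQ c hc).comp_left hP hPc hT hX hb)⟩⟩
end
end

section
/- Let T ⊆ B(H,K) be a TRO, X ⊆ T a nondegenerate sub-TRO, and P : T → X a contractive TRO conditional expectation onto X. Let Q : ⟨T T*⟩ → ⟨T T*⟩ and Q' : ⟨T* T⟩ → ⟨T* T⟩ be the unique contractive linear maps with Q(a x*) = P(a) x* and Q'(x* a) = x* P(a) for a ∈ T, x ∈ X. Then the block map E : A_T → A_T defined by E([[c, t], [s*, d]]) = [[Q(c), P(t)], [P(s)*, Q'(d)]] (for c ∈ ⟨T T*⟩, t, s ∈ T, d ∈ ⟨T* T⟩) is a well-defined conditional expectation from the linking algebra A_T onto the linking algebra A_X: it is a contractive linear idempotent map with range A_X satisfying E(a b) = E(a)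 b and E(b a) = b E(a) for all a ∈ A_T, b ∈ A_X. -/
noncomputable section

open ContinuousLinearMap

variable {H K : Type*} [NormedAddCommGroup H] [InnerProductSpace ℂ H] [CompleteSpace H]
  [NormedAddCommGroup K] [InnerProductSpace ℂ K] [CompleteSpace K]

/-- The block operator `[[c, t], [s, d]]` on the Hilbert space direct sum `K ⊕ H`. -/
def blockOp (c : K →L[ℂ] K) (t : H →L[ℂ] K) (s : K →L[ℂ] H) (d : H →L[ℂ] H) :
    WithLp 2 (K × H) →L[ℂ] WithLp 2 (K × H) :=
  ((WithLp.prodContinuousLinearEquiv 2 ℂ K H).symm :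
      (K × H) →L[ℂ] WithLp 2 (K × H)) ∘L
    ((c ∘L ContinuousLinearMap.fst ℂ K H + t ∘L ContinuousLinearMap.snd ℂ K H).prod
      (s ∘L ContinuousLinearMap.fst ℂ K H + d ∘L ContinuousLinearMap.snd ℂ K H)) ∘L
    ((WithLp.prodContinuousLinearEquiv 2 ℂ K H : WithLp 2 (K × H) →L[ℂ] K × H))

/-- The linking algebra `A_T ⊆ B(K ⊕ H)` of a TRO `T`, consisting of the block operators
`[[c, t], [s*, d]]` with `c ∈ ⟨T T*⟩`, `t, s ∈ T`, `d ∈ ⟨T* T⟩`. -/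
def linkingAlgebra (T : Set (H →L[ℂ] K)) :
    Set (WithLp 2 (K × H) →L[ℂ] WithLp 2 (K × H)) :=
  {w | ∃ c ∈ cspan (setMulStar T T), ∃ t ∈ T, ∃ s ∈ T, ∃ d ∈ cspan (setStarMul T T),
    w = blockOp c t (ContinuousLinearMap.adjoint s) d}

/-- The corner copy `[[0, t], [0, 0]]` of `t ∈ T` inside the linking algebra. -/
def cornerOp (t : H →L[ℂ] K) : WithLp 2 (K × H) →L[ℂ] WithLp 2 (K × H) :=
  blockOp 0 t 0 0

/-- A conditional expectation from a C*-algebra of operators `A` onto a subalgebra `B`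
(formalised as a map of the ambient operator algebra which is linear and contractive
on `A`, maps `A` into `B`, fixes `B` and is a `B`-bimodule map on `A`). -/
def IsCondExp {L : Type*} [NormedAddCommGroup L] [InnerProductSpace ℂ L] [CompleteSpace L]
    (A B : Set (L →L[ℂ] L)) (E : (L →L[ℂ] L) → (L →L[ℂ] L)) : Prop :=
  (∀ a ∈ A, ∀ b ∈ A, E (a + b) = E a + E b) ∧
  (∀ (z : ℂ), ∀ a ∈ A, E (z • a) = z • E a) ∧
  (∀ a ∈ A, ‖E a‖ ≤ ‖a‖) ∧
  (∀ a ∈ A, E a ∈ B) ∧ (∀ b ∈ B, E b = b) ∧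
  (∀ a ∈ A, ∀ b ∈ B, E (a ∘L b) = E a ∘L b ∧ E (b ∘L a) = b ∘L E a)

section ClosedSpan

variable {V W U : Type*} [NormedAddCommGroup V] [NormedSpace ℂ V]
  [NormedAddCommGroup W] [NormedSpace ℂ W] [NormedAddCommGroup U] [NormedSpace ℂ U]

/-- The closed linear span as a submodule; its carrier is `cspan S`. -/
def closedSpan (S : Set V) : Submodule ℂ V :=
  (Submodule.span ℂ S).topologicalClosure

theorem subset_closedSpan {S : Set V} {v : V} (hv : v ∈ S) : v ∈ closedSpan S :=
  subset_closure (Submodule.subset_span hv)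

theorem isClosed_closedSpan (S : Set V) : IsClosed (closedSpan S : Set V) :=
  isClosed_closure

/-- A map that is linear and bounded on the submodule `M`. -/
structure IsBoundedLinearOn (M : Submodule ℂ V) (f : V → W) : Prop where
  map_add : ∀ u ∈ M, ∀ v ∈ M, f (u + v) = f u + f v
  map_smul : ∀ (z : ℂ), ∀ v ∈ M, f (z • v) = z • f v
  bound : ∃ C, ∀ v ∈ M, ‖f v‖ ≤ C * ‖v‖

namespace IsBoundedLinearOn

variable {M : Submodule ℂ V} {f g : V → W}

theorem map_zero (hf : IsBoundedLinearOn M f) : f 0 = 0 := by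
  simpa using hf.map_smul 0 0 M.zero_mem

theorem map_sub (hf : IsBoundedLinearOn M f) {u v : V} (hu : u ∈ M) (hv : v ∈ M) :
    f (u - v) = f u - f v := by
  have h := hf.map_add u hu _ (M.smul_mem (-1 : ℂ) hv)
  rw [hf.map_smul _ v hv] at h
  simpa [sub_eq_add_neg] using h

theorem of_clm (M : Submodule ℂ V) (A : V →L[ℂ] W) : IsBoundedLinearOn M A :=
  ⟨fun u _ v _ => A.map_add u v, fun z v _ => A.map_smul z v, ‖A‖, fun v _ => A.le_opNorm v⟩

theorem clm_comp (hf : IsBoundedLinearOn M f) (A : W →L[ℂ] U) :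
    IsBoundedLinearOn M (fun v => A (f v)) := by
  obtain ⟨C, hC⟩ := hf.bound
  refine ⟨fun u hu v hv => by simp [hf.map_add u hu v hv],
    fun z v hv => by simp [hf.map_smul z v hv], ‖A‖ * C, fun v hv => ?_⟩
  calc ‖A (f v)‖ ≤ ‖A‖ * ‖f v‖ := A.le_opNorm _
    _ ≤ ‖A‖ * (C * ‖v‖) := by gcongr; exact hC v hv
    _ = ‖A‖ * C * ‖v‖ := by ring

theorem comp_clm (hf : IsBoundedLinearOn M f) {N : Submodule ℂ U} (A : U →L[ℂ] V)
    (hA : ∀ u ∈ N, A u ∈ M) : IsBoundedLinearOn N (fun u => f (A u)) := by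
  obtain ⟨C, hC⟩ := hf.bound
  refine ⟨fun u hu v hv => by simp [hf.map_add _ (hA u hu) _ (hA v hv)],
    fun z v hv => by simp [hf.map_smul z _ (hA v hv)], |C| * ‖A‖, fun v hv => ?_⟩
  calc ‖f (A v)‖ ≤ C * ‖A v‖ := hC _ (hA v hv)
    _ ≤ |C| * (‖A‖ * ‖v‖) := by
      gcongr
      · exact le_abs_self C
      · exact A.le_opNorm v
    _ = |C| * ‖A‖ * ‖v‖ := by ring

theorem sub (hf : IsBoundedLinearOn M f) (hg : IsBoundedLinearOn M g) :
    IsBoundedLinearOn M (fun v => f v - g v) := by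
  obtain ⟨C, hC⟩ := hf.bound
  obtain ⟨D, hD⟩ := hg.bound
  refine ⟨fun u hu v hv => ?_, fun z v hv => ?_, C + D, fun v hv => ?_⟩
  · rw [hf.map_add u hu v hv, hg.map_add u hu v hv]; abel
  · rw [hf.map_smul z v hv, hg.map_smul z v hv, smul_sub]
  · calc ‖f v - g v‖ ≤ ‖f v‖ + ‖g v‖ := norm_sub_le _ _
      _ ≤ C * ‖v‖ + D * ‖v‖ := add_le_add (hC v hv) (hD v hv)
      _ = (C + D) * ‖v‖ := by ring

theorem continuousOn (hf : IsBoundedLinearOn M f) : ContinuousOn f M := by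
  obtain ⟨C, hC⟩ := hf.bound
  refine (LipschitzOnWith.of_dist_le_mul (K := C.toNNReal) fun u hu v hv => ?_).continuousOn
  rw [dist_eq_norm, dist_eq_norm, ← hf.map_sub hu hv]
  refine (hC _ (M.sub_mem hu hv)).trans ?_
  gcongr
  exact Real.le_coe_toNNReal C

theorem mapsTo_closedSpan {S : Set V} (hf : IsBoundedLinearOn (closedSpan S) f)
    {N : Submodule ℂ W} (hN : IsClosed (N : Set W)) (h : ∀ s ∈ S, f s ∈ N) :
    ∀ v ∈ closedSpan S, f v ∈ N := by
  have key : Set.MapsTo f (Submodule.span ℂ S : Set V) N := by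
    intro v hv
    have hle : ∀ w ∈ Submodule.span ℂ S, w ∈ closedSpan S := fun w hw => subset_closure hw
    refine Submodule.span_induction (p := fun v _ => f v ∈ N) h ?_ ?_ ?_ hv
    · rw [hf.map_zero]; exact N.zero_mem
    · intro x y hx hy hfx hfy
      rw [hf.map_add x (hle x hx) y (hle y hy)]; exact N.add_mem hfx hfy
    · intro z x hx hfx
      rw [hf.map_smul z x (hle x hx)]; exact N.smul_mem z hfx
  intro v hv
  have := key.closure_of_continuousOn hf.continuousOn hv
  rwa [hN.closure_eq] at this

theorem eqOn_closedSpan {S : Set V} (hf : IsBoundedLinearOn (closedSpan S) f)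
    (hg : IsBoundedLinearOn (closedSpan S) g) (h : ∀ s ∈ S, f s = g s) :
    ∀ v ∈ closedSpan S, f v = g v := fun v hv => by
  have := (hf.sub hg).mapsTo_closedSpan (N := ⊥) (by simp)
    (fun s hs => by simp [h s hs]) v hv
  simpa [sub_eq_zero] using this

end IsBoundedLinearOn

theorem closedSpan_induction {S : Set V} (A : V →L[ℂ] W) {N : Submodule ℂ W}
    (hN : IsClosed (N : Set W)) (h : ∀ s ∈ S, A s ∈ N) : ∀ v ∈ closedSpan S, A v ∈ N :=
  (IsBoundedLinearOn.of_clm _ A).mapsTo_closedSpan hN h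

theorem closedSpan_le {S : Set V} {N : Submodule ℂ V} (hN : IsClosed (N : Set V))
    (h : S ⊆ N) : closedSpan S ≤ N :=
  closedSpan_induction (ContinuousLinearMap.id ℂ V) hN h

end ClosedSpan

section Adjoint

variable {H₁ H₂ : Type*} [NormedAddCommGroup H₁] [InnerProductSpace ℂ H₁] [CompleteSpace H₁]
  [NormedAddCommGroup H₂] [InnerProductSpace ℂ H₂] [CompleteSpace H₂]

theorem IsBoundedLinearOn.adjoint_conj {M : Submodule ℂ (H₁ →L[ℂ] H₁)}
    {f : (H₁ →L[ℂ] H₁) → (H₁ →L[ℂ] H₁)} (hf : IsBoundedLinearOn M f)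
    (hM : ∀ v ∈ M, adjoint v ∈ M) :
    IsBoundedLinearOn M (fun v => adjoint (f (adjoint v))) := by
  obtain ⟨C, hC⟩ := hf.bound
  refine ⟨fun u hu v hv => ?_, fun z v hv => ?_, C, fun v hv => ?_⟩
  · simp [hf.map_add _ (hM u hu) _ (hM v hv)]
  · simp [hf.map_smul _ _ (hM v hv), map_smulₛₗ]
  · simpa using hC _ (hM v hv)

theorem adjoint_mem_closedSpan {S : Set (H₁ →L[ℂ] H₂)} {N : Submodule ℂ (H₂ →L[ℂ] H₁)}
    (hN : IsClosed (N : Set (H₂ →L[ℂ] H₁))) (h : ∀ s ∈ S, adjoint s ∈ N) :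
    ∀ v ∈ closedSpan S, adjoint v ∈ N := by
  let N' : Submodule ℂ (H₁ →L[ℂ] H₂) :=
    { carrier := {v | adjoint v ∈ N}
      add_mem' := fun {a b} ha hb => by
        simpa using N.add_mem ha hb
      zero_mem' := by simp
      smul_mem' := fun c x hx => by
        simpa [map_smulₛₗ] using N.smul_mem (starRingEnd ℂ c) hx }
  have hN' : IsClosed (N' : Set (H₁ →L[ℂ] H₂)) := hN.preimage (adjoint (𝕜 := ℂ)).continuous
  exact closedSpan_le hN' h

end Adjoint

/-- Left composition with a fixed operator, as a continuous linear map. -/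
abbrev compLeft {E F G : Type*} [NormedAddCommGroup E] [NormedSpace ℂ E]
    [NormedAddCommGroup F] [NormedSpace ℂ F] [NormedAddCommGroup G] [NormedSpace ℂ G]
    (A : F →L[ℂ] G) : (E →L[ℂ] F) →L[ℂ] (E →L[ℂ] G) :=
  ContinuousLinearMap.compL ℂ E F G A

/-- Right composition with a fixed operator, as a continuous linear map. -/
abbrev compRight {E F G : Type*} [NormedAddCommGroup E] [NormedSpace ℂ E]
    [NormedAddCommGroup F] [NormedSpace ℂ F] [NormedAddCommGroup G] [NormedSpace ℂ G]
    (B : E →L[ℂ] F) : (F →L[ℂ] G) →L[ℂ] (E →L[ℂ] G) :=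
  (ContinuousLinearMap.compL ℂ E F G).flip B

/-- The left algebra `⟨T T*⟩` of a subspace `T` of operators. -/
abbrev leftAlg (T : Submodule ℂ (H →L[ℂ] K)) : Submodule ℂ (K →L[ℂ] K) :=
  closedSpan (setMulStar (T : Set (H →L[ℂ] K)) T)

/-- The right algebra `⟨T* T⟩` of a subspace `T` of operators. -/
abbrev rightAlg (T : Submodule ℂ (H →L[ℂ] K)) : Submodule ℂ (H →L[ℂ] H) :=
  closedSpan (setStarMul (T : Set (H →L[ℂ] K)) T)

section TernaryRing

variable {T X : Submodule ℂ (H →L[ℂ] K)}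

theorem comp_adjoint_mem_leftAlg {a b : H →L[ℂ] K} (ha : a ∈ T) (hb : b ∈ T) :
    a ∘L adjoint b ∈ leftAlg T :=
  subset_closedSpan ⟨a, ha, b, hb, rfl⟩

theorem adjoint_comp_mem_rightAlg {a b : H →L[ℂ] K} (ha : a ∈ T) (hb : b ∈ T) :
    adjoint a ∘L b ∈ rightAlg T :=
  subset_closedSpan ⟨a, ha, b, hb, rfl⟩

theorem adjoint_mem_leftAlg : ∀ c ∈ leftAlg T, adjoint c ∈ leftAlg T := by
  refine adjoint_mem_closedSpan (isClosed_closedSpan _) ?_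
  rintro _ ⟨a, ha, b, hb, rfl⟩
  simpa [adjoint_comp] using comp_adjoint_mem_leftAlg hb ha

theorem adjoint_mem_rightAlg : ∀ d ∈ rightAlg T, adjoint d ∈ rightAlg T := by
  refine adjoint_mem_closedSpan (isClosed_closedSpan _) ?_
  rintro _ ⟨a, ha, b, hb, rfl⟩
  simpa [adjoint_comp] using adjoint_comp_mem_rightAlg hb ha

theorem leftAlg_mono (h : X ≤ T) : leftAlg X ≤ leftAlg T := by
  refine closedSpan_le (isClosed_closedSpan _) ?_
  rintro _ ⟨a, ha, b, hb, rfl⟩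
  exact comp_adjoint_mem_leftAlg (h ha) (h hb)

theorem rightAlg_mono (h : X ≤ T) : rightAlg X ≤ rightAlg T := by
  refine closedSpan_le (isClosed_closedSpan _) ?_
  rintro _ ⟨a, ha, b, hb, rfl⟩
  exact adjoint_comp_mem_rightAlg (h ha) (h hb)

/-- A closed subspace stable under the ternary product. -/
structure IsTernaryRing (T : Submodule ℂ (H →L[ℂ] K)) : Prop where
  isClosed : IsClosed (T : Set (H →L[ℂ] K))
  tp_mem : ∀ a ∈ T, ∀ b ∈ T, ∀ c ∈ T, tp a b c ∈ T

namespace IsTernaryRing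

theorem leftAlg_comp_mem (hT : IsTernaryRing T) {c : K →L[ℂ] K} (hc : c ∈ leftAlg T)
    {t : H →L[ℂ] K} (ht : t ∈ T) : c ∘L t ∈ T := by
  refine closedSpan_induction (compRight t) hT.isClosed ?_ c hc
  rintro _ ⟨a, ha, b, hb, rfl⟩
  exact hT.tp_mem a ha b hb t ht

theorem comp_rightAlg_mem (hT : IsTernaryRing T) {d : H →L[ℂ] H} (hd : d ∈ rightAlg T)
    {t : H →L[ℂ] K} (ht : t ∈ T) : t ∘L d ∈ T := by
  refine closedSpan_induction (compLeft t) hT.isClosed ?_ d hd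
  rintro _ ⟨a, ha, b, hb, rfl⟩
  exact hT.tp_mem t ht a ha b hb

theorem leftAlg_comp_leftAlg_mem (hT : IsTernaryRing T) {c c' : K →L[ℂ] K}
    (hc : c ∈ leftAlg T) (hc' : c' ∈ leftAlg T) : c ∘L c' ∈ leftAlg T := by
  refine closedSpan_induction (compLeft c) (isClosed_closedSpan _) ?_ c' hc'
  rintro _ ⟨a, ha, b, hb, rfl⟩
  simpa [ContinuousLinearMap.comp_assoc] using
    comp_adjoint_mem_leftAlg (hT.leftAlg_comp_mem hc ha) hb

theorem rightAlg_comp_rightAlg_mem (hT : IsTernaryRing T) {d d' : H →L[ℂ] H}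
    (hd : d ∈ rightAlg T) (hd' : d' ∈ rightAlg T) : d ∘L d' ∈ rightAlg T := by
  refine closedSpan_induction (compRight (G := H) d') (isClosed_closedSpan _) ?_ d hd
  rintro _ ⟨a, ha, b, hb, rfl⟩
  simpa [ContinuousLinearMap.comp_assoc] using
    adjoint_comp_mem_rightAlg ha (hT.comp_rightAlg_mem hd' hb)

end IsTernaryRing

theorem eq_zero_of_leftAlg_comp_eq_zero {w : K →L[ℂ] K} (hw : w ∈ leftAlg X)
    (h : ∀ x ∈ X, w ∘L x = 0) : w = 0 := by
  have key : ∀ v ∈ leftAlg X, w ∘L v ∈ (⊥ : Submodule ℂ (K →L[ℂ] K)) := by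
    refine closedSpan_induction (compLeft w) (by simp) ?_
    rintro _ ⟨a, ha, b, -, rfl⟩
    simp [← ContinuousLinearMap.comp_assoc, h a ha]
  have hz : adjoint (adjoint w) ∘L adjoint w = 0 := by
    simpa using key _ (adjoint_mem_leftAlg w hw)
  rw [adjoint_comp_self_eq_zero_iff] at hz
  simpa using hz

theorem eq_zero_of_comp_rightAlg_eq_zero {w : H →L[ℂ] H} (hw : w ∈ rightAlg X)
    (h : ∀ x ∈ X, x ∘L w = 0) : w = 0 := by
  have key : ∀ v ∈ rightAlg X, v ∘L w ∈ (⊥ : Submodule ℂ (H →L[ℂ] H)) := by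
    refine closedSpan_induction (compRight (G := H) w) (by simp) ?_
    rintro _ ⟨a, -, b, hb, rfl⟩
    simp [ContinuousLinearMap.comp_assoc, h b hb]
  have hz : adjoint w ∘L w = 0 := by
    simpa using key _ (adjoint_mem_rightAlg w hw)
  rwa [adjoint_comp_self_eq_zero_iff] at hz

end TernaryRing

/-- A contractive TRO conditional expectation `P` of `T` onto a nondegenerate sub-TRO `X`,
together with its corner maps `Q` and `Q'`. -/
structure IsCornerSystem (T X : Submodule ℂ (H →L[ℂ] K)) (P : (H →L[ℂ] K) → (H →L[ℂ] K))
    (Q : (K →L[ℂ] K) → (K →L[ℂ] K)) (Q' : (H →L[ℂ] H) → (H →L[ℂ] H)) : Prop where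
  ternary : IsTernaryRing T
  sub_ternary : IsTernaryRing X
  le : X ≤ T
  nondegenerate : Nondegenerate (T : Set (H →L[ℂ] K)) X
  condExp : IsTROCondExp (T : Set (H →L[ℂ] K)) X P
  contractive : ContractiveOn (T : Set (H →L[ℂ] K)) P
  left : IsLeftCornerMap (T : Set (H →L[ℂ] K)) X P Q
  right : IsRightCornerMap (T : Set (H →L[ℂ] K)) X P Q'

namespace IsCornerSystem

variable {T X : Submodule ℂ (H →L[ℂ] K)} {P : (H →L[ℂ] K) → (H →L[ℂ] K)}
  {Q : (K →L[ℂ] K) → (K →L[ℂ] K)} {Q' : (H →L[ℂ] H) → (H →L[ℂ] H)}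

theorem P_mem (h : IsCornerSystem T X P Q Q') {t : H →L[ℂ] K} (ht : t ∈ T) : P t ∈ X :=
  h.condExp.2.2.1 t ht

theorem P_eq_self (h : IsCornerSystem T X P Q Q') {x : H →L[ℂ] K} (hx : x ∈ X) : P x = x :=
  h.condExp.2.2.2.1 x hx

theorem P_linear (h : IsCornerSystem T X P Q Q') : IsBoundedLinearOn T P :=
  ⟨h.condExp.1, h.condExp.2.1, 1, fun v hv => by simpa using h.contractive v hv⟩

theorem Q_linear (h : IsCornerSystem T X P Q Q') : IsBoundedLinearOn (leftAlg T) Q :=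
  ⟨h.left.2.1, h.left.2.2.1, 1, fun v hv => by simpa using h.left.2.2.2.1 v hv⟩

theorem Q'_linear (h : IsCornerSystem T X P Q Q') : IsBoundedLinearOn (rightAlg T) Q' :=
  ⟨h.right.2.1, h.right.2.2.1, 1, fun v hv => by simpa using h.right.2.2.2.1 v hv⟩

theorem Q_comp_adjoint (h : IsCornerSystem T X P Q Q') {a x : H →L[ℂ] K} (ha : a ∈ T)
    (hx : x ∈ X) : Q (a ∘L adjoint x) = P a ∘L adjoint x :=
  h.left.2.2.2.2 a ha x hx

theorem Q'_adjoint_comp (h : IsCornerSystem T X P Q Q') {a x : H →L[ℂ] K} (ha : a ∈ T)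
    (hx : x ∈ X) : Q' (adjoint x ∘L a) = adjoint x ∘L P a :=
  h.right.2.2.2.2 a ha x hx

/-- Nondegeneracy gives `⟨T T*⟩ = ⟨T X*⟩`. -/
theorem leftAlg_eq (h : IsCornerSystem T X P Q Q') :
    leftAlg T = closedSpan (setMulStar (T : Set (H →L[ℂ] K)) X) := by
  refine le_antisymm (closedSpan_le (isClosed_closedSpan _) ?_)
    (closedSpan_le (isClosed_closedSpan _) ?_)
  · rintro _ ⟨a, ha, b, hb, rfl⟩
    have hb' : b ∈ closedSpan {w | ∃ x ∈ (X : Set (H →L[ℂ] K)), ∃ a ∈ (T : Set (H →L[ℂ] K)),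
        ∃ b ∈ (T : Set (H →L[ℂ] K)), w = tp x a b} := by
      change b ∈ cspan _
      rw [h.nondegenerate.1]; exact hb
    rw [← adjoint_adjoint a, ← adjoint_comp]
    refine adjoint_mem_closedSpan (S := setMulStar (X : Set (H →L[ℂ] K)) T)
      (isClosed_closedSpan _) ?_ _
      (closedSpan_induction (compRight (adjoint a)) (isClosed_closedSpan _) ?_ b hb')
    · rintro _ ⟨x, hx, t, ht, rfl⟩
      exact subset_closedSpan ⟨t, ht, x, hx, by simp [adjoint_comp]⟩
    · rintro _ ⟨x, hx, a₁, ha₁, b₁, hb₁, rfl⟩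
      refine subset_closedSpan ⟨x, hx, tp a b₁ a₁, h.ternary.tp_mem _ ha _ hb₁ _ ha₁, ?_⟩
      simp [tp, adjoint_comp, ContinuousLinearMap.comp_assoc]
  · rintro _ ⟨a, ha, b, hb, rfl⟩
    exact comp_adjoint_mem_leftAlg ha (h.le hb)

/-- Nondegeneracy gives `⟨T* T⟩ = ⟨X* T⟩`. -/
theorem rightAlg_eq (h : IsCornerSystem T X P Q Q') :
    rightAlg T = closedSpan (setStarMul (X : Set (H →L[ℂ] K)) T) := by
  refine le_antisymm (closedSpan_le (isClosed_closedSpan _) ?_)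
    (closedSpan_le (isClosed_closedSpan _) ?_)
  · rintro _ ⟨a, ha, b, hb, rfl⟩
    have ha' : a ∈ closedSpan {w | ∃ a ∈ (T : Set (H →L[ℂ] K)), ∃ b ∈ (T : Set (H →L[ℂ] K)),
        ∃ x ∈ (X : Set (H →L[ℂ] K)), w = tp a b x} := by
      change a ∈ cspan _
      rw [h.nondegenerate.2]; exact ha
    rw [← adjoint_adjoint b, ← adjoint_comp]
    refine adjoint_mem_closedSpan (S := setStarMul (T : Set (H →L[ℂ] K)) X)
      (isClosed_closedSpan _) ?_ _
      (closedSpan_induction (compLeft (adjoint b)) (isClosed_closedSpan _) ?_ a ha')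
    · rintro _ ⟨t, ht, x, hx, rfl⟩
      exact subset_closedSpan ⟨x, hx, t, ht, by simp [adjoint_comp]⟩
    · rintro _ ⟨a₁, ha₁, b₁, hb₁, x, hx, rfl⟩
      refine subset_closedSpan ⟨tp b₁ a₁ b, h.ternary.tp_mem _ hb₁ _ ha₁ _ hb, x, hx, ?_⟩
      simp [tp, adjoint_comp, ContinuousLinearMap.comp_assoc]
  · rintro _ ⟨a, ha, b, hb, rfl⟩
    exact adjoint_comp_mem_rightAlg (h.le ha) hb

theorem Q_mem (h : IsCornerSystem T X P Q Q') {c : K →L[ℂ] K} (hc : c ∈ leftAlg T) :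
    Q c ∈ leftAlg X := by
  have hQ := h.Q_linear
  rw [h.leftAlg_eq] at hQ hc
  refine hQ.mapsTo_closedSpan (isClosed_closedSpan _) ?_ c hc
  rintro _ ⟨a, ha, x, hx, rfl⟩
  rw [h.Q_comp_adjoint ha hx]
  exact comp_adjoint_mem_leftAlg (h.P_mem ha) hx

theorem Q'_mem (h : IsCornerSystem T X P Q Q') {d : H →L[ℂ] H} (hd : d ∈ rightAlg T) :
    Q' d ∈ rightAlg X := by
  have hQ := h.Q'_linear
  rw [h.rightAlg_eq] at hQ hd
  refine hQ.mapsTo_closedSpan (isClosed_closedSpan _) ?_ d hd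
  rintro _ ⟨x, hx, a, ha, rfl⟩
  rw [h.Q'_adjoint_comp ha hx]
  exact adjoint_comp_mem_rightAlg hx (h.P_mem ha)

/-- `P(c x) = Q(c) x` for `c ∈ ⟨T T*⟩` and `x ∈ X`. -/
theorem P_left_comp (h : IsCornerSystem T X P Q Q') {c : K →L[ℂ] K} (hc : c ∈ leftAlg T)
    {x : H →L[ℂ] K} (hx : x ∈ X) : P (c ∘L x) = Q c ∘L x := by
  have h₁ : IsBoundedLinearOn (leftAlg T) (fun c => P (c ∘L x)) :=
    h.P_linear.comp_clm (compRight x) fun c hc => h.ternary.leftAlg_comp_mem hc (h.le hx)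
  have h₂ : IsBoundedLinearOn (leftAlg T) (fun c => Q c ∘L x) := h.Q_linear.clm_comp (compRight x)
  rw [h.leftAlg_eq] at h₁ h₂ hc
  refine h₁.eqOn_closedSpan h₂ ?_ c hc
  rintro _ ⟨a, ha, y, hy, rfl⟩
  rw [h.Q_comp_adjoint ha hy]
  exact h.condExp.2.2.2.2.1 a ha y hy x hx

/-- `P(x d) = x Q'(d)` for `d ∈ ⟨T* T⟩` and `x ∈ X`. -/
theorem P_comp_right (h : IsCornerSystem T X P Q Q') {d : H →L[ℂ] H} (hd : d ∈ rightAlg T)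
    {x : H →L[ℂ] K} (hx : x ∈ X) : P (x ∘L d) = x ∘L Q' d := by
  have h₁ : IsBoundedLinearOn (rightAlg T) (fun d => P (x ∘L d)) :=
    h.P_linear.comp_clm (compLeft x) fun d hd => h.ternary.comp_rightAlg_mem hd (h.le hx)
  have h₂ : IsBoundedLinearOn (rightAlg T) (fun d => x ∘L Q' d) :=
    h.Q'_linear.clm_comp (compLeft x)
  rw [h.rightAlg_eq] at h₁ h₂ hd
  refine h₁.eqOn_closedSpan h₂ ?_ d hd
  rintro _ ⟨y, hy, a, ha, rfl⟩
  rw [h.Q'_adjoint_comp ha hy]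
  exact h.condExp.2.2.2.2.2.2 a ha x hx y hy

/-- `P(c t) = c P(t)` for `c ∈ ⟨X X*⟩` and `t ∈ T`. -/
theorem P_subLeft_comp (h : IsCornerSystem T X P Q Q') {c : K →L[ℂ] K} (hc : c ∈ leftAlg X)
    {t : H →L[ℂ] K} (ht : t ∈ T) : P (c ∘L t) = c ∘L P t := by
  refine IsBoundedLinearOn.eqOn_closedSpan (f := fun c => P (c ∘L t))
    (h.P_linear.comp_clm (compRight t) fun c hc =>
      h.ternary.leftAlg_comp_mem (leftAlg_mono h.le hc) ht)
    (IsBoundedLinearOn.of_clm _ (compRight (P t))) ?_ c hc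
  rintro _ ⟨x, hx, y, hy, rfl⟩
  exact h.condExp.2.2.2.2.2.2 t ht x hx y hy

/-- `P(t d) = P(t) d` for `d ∈ ⟨X* X⟩` and `t ∈ T`. -/
theorem P_comp_subRight (h : IsCornerSystem T X P Q Q') {d : H →L[ℂ] H} (hd : d ∈ rightAlg X)
    {t : H →L[ℂ] K} (ht : t ∈ T) : P (t ∘L d) = P t ∘L d := by
  refine IsBoundedLinearOn.eqOn_closedSpan (f := fun d => P (t ∘L d))
    (h.P_linear.comp_clm (compLeft t) fun d hd =>
      h.ternary.comp_rightAlg_mem (rightAlg_mono h.le hd) ht)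
    (IsBoundedLinearOn.of_clm _ (compLeft (P t))) ?_ d hd
  rintro _ ⟨x, hx, y, hy, rfl⟩
  exact h.condExp.2.2.2.2.1 t ht x hx y hy

theorem Q_eq_of_forall_comp (h : IsCornerSystem T X P Q Q') {c w : K →L[ℂ] K}
    (hc : c ∈ leftAlg T) (hw : w ∈ leftAlg X) (hcw : ∀ x ∈ X, P (c ∘L x) = w ∘L x) :
    Q c = w := by
  refine sub_eq_zero.mp (eq_zero_of_leftAlg_comp_eq_zero
    ((leftAlg X).sub_mem (h.Q_mem hc) hw) fun x hx => ?_)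
  rw [ContinuousLinearMap.sub_comp, ← h.P_left_comp hc hx, hcw x hx, sub_self]

theorem Q'_eq_of_forall_comp (h : IsCornerSystem T X P Q Q') {d w : H →L[ℂ] H}
    (hd : d ∈ rightAlg T) (hw : w ∈ rightAlg X) (hdw : ∀ x ∈ X, P (x ∘L d) = x ∘L w) :
    Q' d = w := by
  refine sub_eq_zero.mp (eq_zero_of_comp_rightAlg_eq_zero
    ((rightAlg X).sub_mem (h.Q'_mem hd) hw) fun x hx => ?_)
  rw [ContinuousLinearMap.comp_sub, ← h.P_comp_right hd hx, hdw x hx, sub_self]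

theorem Q_eq_self (h : IsCornerSystem T X P Q Q') {c : K →L[ℂ] K} (hc : c ∈ leftAlg X) :
    Q c = c :=
  h.Q_eq_of_forall_comp (leftAlg_mono h.le hc) hc fun _ hx =>
    h.P_eq_self (h.sub_ternary.leftAlg_comp_mem hc hx)

theorem Q'_eq_self (h : IsCornerSystem T X P Q Q') {d : H →L[ℂ] H} (hd : d ∈ rightAlg X) :
    Q' d = d :=
  h.Q'_eq_of_forall_comp (rightAlg_mono h.le hd) hd fun _ hx =>
    h.P_eq_self (h.sub_ternary.comp_rightAlg_mem hd hx)

theorem Q_comp_subLeft (h : IsCornerSystem T X P Q Q') {c c' : K →L[ℂ] K}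
    (hc : c ∈ leftAlg T) (hc' : c' ∈ leftAlg X) : Q (c ∘L c') = Q c ∘L c' :=
  h.Q_eq_of_forall_comp (h.ternary.leftAlg_comp_leftAlg_mem hc (leftAlg_mono h.le hc'))
    (h.sub_ternary.leftAlg_comp_leftAlg_mem (h.Q_mem hc) hc') fun x hx => by
      simpa [ContinuousLinearMap.comp_assoc] using
        h.P_left_comp hc (h.sub_ternary.leftAlg_comp_mem hc' hx)

theorem Q'_comp_subRight (h : IsCornerSystem T X P Q Q') {d d' : H →L[ℂ] H}
    (hd : d ∈ rightAlg T) (hd' : d' ∈ rightAlg X) : Q' (d ∘L d') = Q' d ∘L d' :=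
  h.Q'_eq_of_forall_comp (h.ternary.rightAlg_comp_rightAlg_mem hd (rightAlg_mono h.le hd'))
    (h.sub_ternary.rightAlg_comp_rightAlg_mem (h.Q'_mem hd) hd') fun x hx => by
      rw [← ContinuousLinearMap.comp_assoc,
        h.P_comp_subRight hd' (h.ternary.comp_rightAlg_mem hd (h.le hx)),
        h.P_comp_right hd hx, ContinuousLinearMap.comp_assoc]

theorem Q_adjoint (h : IsCornerSystem T X P Q Q') {c : K →L[ℂ] K} (hc : c ∈ leftAlg T) :
    Q (adjoint c) = adjoint (Q c) := by
  have h₁ := h.Q_linear.adjoint_conj adjoint_mem_leftAlg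
  have h₂ := h.Q_linear
  rw [h.leftAlg_eq] at h₁ h₂ hc
  rw [← adjoint_adjoint (Q (adjoint c))]
  refine congrArg _ (h₁.eqOn_closedSpan h₂ ?_ c hc)
  rintro _ ⟨a, ha, x, hx, rfl⟩
  have key : Q (x ∘L adjoint a) = x ∘L adjoint (P a) :=
    h.Q_eq_of_forall_comp (comp_adjoint_mem_leftAlg (h.le hx) ha)
      (comp_adjoint_mem_leftAlg hx (h.P_mem ha)) fun y hy =>
        h.condExp.2.2.2.2.2.1 a ha x hx y hy
  simp [adjoint_comp, h.Q_comp_adjoint ha hx, key]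

theorem Q'_adjoint_comp_sub (h : IsCornerSystem T X P Q Q') {a x : H →L[ℂ] K} (ha : a ∈ T)
    (hx : x ∈ X) : Q' (adjoint a ∘L x) = adjoint (P a) ∘L x :=
  h.Q'_eq_of_forall_comp (adjoint_comp_mem_rightAlg ha (h.le hx))
    (adjoint_comp_mem_rightAlg (h.P_mem ha) hx) fun y hy =>
      h.condExp.2.2.2.2.2.1 a ha y hy x hx

theorem Q'_adjoint (h : IsCornerSystem T X P Q Q') {d : H →L[ℂ] H} (hd : d ∈ rightAlg T) :
    Q' (adjoint d) = adjoint (Q' d) := by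
  have h₁ := h.Q'_linear.adjoint_conj adjoint_mem_rightAlg
  have h₂ := h.Q'_linear
  rw [h.rightAlg_eq] at h₁ h₂ hd
  rw [← adjoint_adjoint (Q' (adjoint d))]
  refine congrArg _ (h₁.eqOn_closedSpan h₂ ?_ d hd)
  rintro _ ⟨x, hx, a, ha, rfl⟩
  simp [adjoint_comp, h.Q'_adjoint_comp ha hx, h.Q'_adjoint_comp_sub ha hx]

/-- `X = ⟨X X* X⟩`. -/
theorem sub_le_closedSpan (h : IsCornerSystem T X P Q Q') :
    X ≤ closedSpan {w | ∃ x ∈ X, ∃ d ∈ rightAlg X, w = x ∘L d} := by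
  intro x hx
  have hS : closedSpan {w | ∃ x ∈ (X : Set (H →L[ℂ] K)), ∃ a ∈ (T : Set (H →L[ℂ] K)),
      ∃ b ∈ (T : Set (H →L[ℂ] K)), w = tp x a b} = T :=
    SetLike.coe_injective h.nondegenerate.1
  have hP := h.P_linear
  have hxT := h.le hx
  rw [← hS] at hP hxT
  rw [← h.P_eq_self hx]
  refine hP.mapsTo_closedSpan (isClosed_closedSpan _) ?_ x hxT
  rintro _ ⟨y, hy, a, ha, b, hb, rfl⟩
  have hab := adjoint_comp_mem_rightAlg (T := T) ha hb
  exact subset_closedSpan ⟨y, hy, _, h.Q'_mem hab, h.P_comp_right hab hy⟩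

end IsCornerSystem

section BlockOperators

set_option linter.unusedSectionVars false

@[simp] theorem blockOp_apply (c : K →L[ℂ] K) (t : H →L[ℂ] K) (s : K →L[ℂ] H)
    (d : H →L[ℂ] H) (v : WithLp 2 (K × H)) :
    blockOp c t s d v = WithLp.toLp 2 (c v.fst + t v.snd, s v.fst + d v.snd) :=
  rfl

theorem blockOp_add (c c' : K →L[ℂ] K) (t t' : H →L[ℂ] K) (s s' : K →L[ℂ] H)
    (d d' : H →L[ℂ] H) :
    blockOp c t s d + blockOp c' t' s' d' = blockOp (c + c') (t + t') (s + s') (d + d') := by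
  refine ContinuousLinearMap.ext fun v => WithLp.ofLp_injective 2 (Prod.ext ?_ ?_) <;> simp <;> abel

theorem smul_blockOp (z : ℂ) (c : K →L[ℂ] K) (t : H →L[ℂ] K) (s : K →L[ℂ] H)
    (d : H →L[ℂ] H) :
    z • blockOp c t s d = blockOp (z • c) (z • t) (z • s) (z • d) := by
  refine ContinuousLinearMap.ext fun v => WithLp.ofLp_injective 2 (Prod.ext ?_ ?_) <;> simp

theorem blockOp_comp (c c' : K →L[ℂ] K) (t t' : H →L[ℂ] K) (s s' : K →L[ℂ] H)
    (d d' : H →L[ℂ] H) :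
    blockOp c t s d ∘L blockOp c' t' s' d' =
      blockOp (c ∘L c' + t ∘L s') (c ∘L t' + t ∘L d')
        (s ∘L c' + d ∘L s') (s ∘L t' + d ∘L d') := by
  refine ContinuousLinearMap.ext fun v => WithLp.ofLp_injective 2 (Prod.ext ?_ ?_) <;> simp <;> abel

theorem adjoint_blockOp (c : K →L[ℂ] K) (t : H →L[ℂ] K) (s : K →L[ℂ] H) (d : H →L[ℂ] H) :
    adjoint (blockOp c t s d) = blockOp (adjoint c) (adjoint s) (adjoint t) (adjoint d) := by
  symm
  rw [eq_adjoint_iff]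
  intro x y
  simp [inner_add_left, inner_add_right, adjoint_inner_left]
  ring

/-- The inclusion of the first summand. -/
def inlOp : K →L[ℂ] WithLp 2 (K × H) :=
  ((WithLp.prodContinuousLinearEquiv 2 ℂ K H).symm : (K × H) →L[ℂ] WithLp 2 (K × H)) ∘L
    ContinuousLinearMap.inl ℂ K H

/-- The inclusion of the second summand. -/
def inrOp : H →L[ℂ] WithLp 2 (K × H) :=
  ((WithLp.prodContinuousLinearEquiv 2 ℂ K H).symm : (K × H) →L[ℂ] WithLp 2 (K × H)) ∘L
    ContinuousLinearMap.inr ℂ K H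

@[simp] theorem inlOp_apply (k : K) : inlOp (H := H) k = WithLp.toLp 2 (k, 0) := rfl

@[simp] theorem inrOp_apply (x : H) : inrOp (K := K) x = WithLp.toLp 2 (0, x) := rfl

/-- The block map `[[c, t], [s*, d]] ↦ [[Q(c), P(t)], [P(s)*, Q'(d)]]`. -/
def blockMap (P : (H →L[ℂ] K) → (H →L[ℂ] K)) (Q : (K →L[ℂ] K) → (K →L[ℂ] K))
    (Q' : (H →L[ℂ] H) → (H →L[ℂ] H)) (w : WithLp 2 (K × H) →L[ℂ] WithLp 2 (K × H)) :
    WithLp 2 (K × H) →L[ℂ] WithLp 2 (K × H) :=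
  blockOp (Q (WithLp.fstL 2 ℂ K H ∘L w ∘L inlOp)) (P (WithLp.fstL 2 ℂ K H ∘L w ∘L inrOp))
    (adjoint (P (adjoint (WithLp.sndL 2 ℂ K H ∘L w ∘L inlOp))))
    (Q' (WithLp.sndL 2 ℂ K H ∘L w ∘L inrOp))

theorem blockMap_blockOp (P : (H →L[ℂ] K) → (H →L[ℂ] K)) (Q : (K →L[ℂ] K) → (K →L[ℂ] K))
    (Q' : (H →L[ℂ] H) → (H →L[ℂ] H)) (c : K →L[ℂ] K) (t s : H →L[ℂ] K) (d : H →L[ℂ] H) :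
    blockMap P Q Q' (blockOp c t (adjoint s) d) =
      blockOp (Q c) (P t) (adjoint (P s)) (Q' d) := by
  have h₁ : WithLp.fstL 2 ℂ K H ∘L blockOp c t (adjoint s) d ∘L inlOp = c := by ext; simp
  have h₂ : WithLp.fstL 2 ℂ K H ∘L blockOp c t (adjoint s) d ∘L inrOp = t := by ext; simp
  have h₃ : WithLp.sndL 2 ℂ K H ∘L blockOp c t (adjoint s) d ∘L inlOp = adjoint s := by
    ext; simp
  have h₄ : WithLp.sndL 2 ℂ K H ∘L blockOp c t (adjoint s) d ∘L inrOp = d := by ext; simp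
  rw [blockMap, h₁, h₂, h₃, h₄, adjoint_adjoint]

theorem norm_blockOp_lower_right_le (d : H →L[ℂ] H) :
    ‖blockOp (0 : K →L[ℂ] K) 0 0 d‖ ≤ ‖d‖ := by
  refine ContinuousLinearMap.opNorm_le_bound _ (norm_nonneg d) fun v => ?_
  simp only [blockOp_apply, zero_apply, zero_add, WithLp.norm_toLp_snd]
  exact (d.le_opNorm _).trans (by gcongr; exact WithLp.norm_snd_le _ v)

theorem norm_le_norm_blockOp_lower_right (d : H →L[ℂ] H) :
    ‖d‖ ≤ ‖blockOp (0 : K →L[ℂ] K) 0 0 d‖ := by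
  refine ContinuousLinearMap.opNorm_le_bound _ (norm_nonneg _) fun x => ?_
  simpa using (blockOp (0 : K →L[ℂ] K) 0 0 d).le_opNorm (WithLp.toLp 2 (0, x))

end BlockOperators

/-- In a C*-algebra, a self-adjoint `w` has norm at most `M` if its powers grow no faster than
`M ^ n` on a set whose closed linear span contains `w`. -/
theorem IsSelfAdjoint.norm_le_of_norm_pow_mul_le {A : Type*} [NormedRing A] [NormedAlgebra ℂ A]
    [StarRing A] [CStarRing A] {w : A} (hw : IsSelfAdjoint w) {S : Set A}
    (hS : w ∈ closedSpan S) {M : ℝ} (hM : 0 ≤ M)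
    (h : ∀ s ∈ S, ∃ C, ∀ n : ℕ, ‖w ^ n * s‖ ≤ C * M ^ n) : ‖w‖ ≤ M := by
  by_contra! hlt
  have hpos : 0 < ‖w‖ := hM.trans_lt hlt
  obtain ⟨u, hu, hwu⟩ := Metric.mem_closure_iff.mp hS (‖w‖ / 2) (by positivity)
  have hC : ∃ C, ∀ n : ℕ, ‖w ^ n * u‖ ≤ C * M ^ n := by
    refine Submodule.span_induction (p := fun u _ => ∃ C, ∀ n : ℕ, ‖w ^ n * u‖ ≤ C * M ^ n)
      h ⟨0, by simp⟩ ?_ ?_ hu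
    · rintro x y - - ⟨C, hC⟩ ⟨D, hD⟩
      refine ⟨C + D, fun n => ?_⟩
      rw [mul_add, add_mul]
      exact (norm_add_le _ _).trans (add_le_add (hC n) (hD n))
    · rintro z x - ⟨C, hC⟩
      refine ⟨‖z‖ * C, fun n => ?_⟩
      rw [mul_smul_comm, norm_smul, mul_assoc]
      gcongr
      exact hC n
  obtain ⟨C, hC⟩ := hC
  have hC0 : 0 ≤ C := by simpa using (norm_nonneg _).trans (hC 0)
  obtain ⟨N, hN⟩ := exists_pow_lt_of_lt_one (show 0 < ‖w‖ / (2 * (C + 1)) by positivity)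
    ((div_lt_one hpos).mpr hlt)
  obtain ⟨n, hn⟩ : ∃ n, 2 ^ (N + 1) = n + 1 := ⟨2 ^ (N + 1) - 1, by
    have := Nat.one_le_two_pow (n := N + 1); omega⟩
  have hNn : N + 1 ≤ n := by
    have := Nat.lt_two_pow_self (n := N + 1); omega
  have hle : (M / ‖w‖) ^ n ≤ (M / ‖w‖) ^ N :=
    pow_le_pow_of_le_one (by positivity) ((div_lt_one hpos).mpr hlt).le (by omega)
  have hpow : ‖w‖ ^ (n + 1) ≤ ‖w‖ ^ n * (‖w‖ / 2) + C * M ^ n := by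
    calc ‖w‖ ^ (n + 1) = ‖w ^ n * (w - u) + w ^ n * u‖ := by
          rw [← mul_add, sub_add_cancel, ← pow_succ, ← hn, hw.norm_pow_two_pow]
      _ ≤ ‖w ^ n‖ * ‖w - u‖ + ‖w ^ n * u‖ :=
          (norm_add_le _ _).trans (by gcongr; exact norm_mul_le _ _)
      _ ≤ ‖w‖ ^ n * (‖w‖ / 2) + C * M ^ n := by
          gcongr
          · exact norm_pow_le' w (by omega)
          · rw [← dist_eq_norm]; exact hwu.le
          · exact hC n
  have hMn : M ^ n = (M / ‖w‖) ^ n * ‖w‖ ^ n := by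
    rw [← mul_pow, div_mul_cancel₀ _ hpos.ne']
  have hwn : 0 < ‖w‖ ^ n := by positivity
  have hhalf : ‖w‖ / 2 ≤ C * (M / ‖w‖) ^ n := by
    rw [hMn, pow_succ] at hpow
    nlinarith
  have hlt' : (M / ‖w‖) ^ n * (2 * (C + 1)) < ‖w‖ := by
    rw [← lt_div_iff₀ (by positivity)]; exact hle.trans_lt hN
  have : 0 ≤ (M / ‖w‖) ^ n := by positivity
  nlinarith

/-- The operators `[[0, x], [0, d]]` with `x ∈ X` and `d ∈ ⟨X* X⟩`. -/
def columns (X : Submodule ℂ (H →L[ℂ] K)) :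
    Set (WithLp 2 (K × H) →L[ℂ] WithLp 2 (K × H)) :=
  {b | ∃ x ∈ X, ∃ d ∈ rightAlg X, b = blockOp 0 x 0 d}

namespace IsCornerSystem

variable {T X : Submodule ℂ (H →L[ℂ] K)} {P : (H →L[ℂ] K) → (H →L[ℂ] K)}
  {Q : (K →L[ℂ] K) → (K →L[ℂ] K)} {Q' : (H →L[ℂ] H) → (H →L[ℂ] H)}

theorem adjoint_mem_linkingAlgebra {a : WithLp 2 (K × H) →L[ℂ] WithLp 2 (K × H)}
    (ha : a ∈ linkingAlgebra (T : Set (H →L[ℂ] K))) :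
    adjoint a ∈ linkingAlgebra (T : Set (H →L[ℂ] K)) := by
  obtain ⟨c, hc, t, ht, s, hs, d, hd, rfl⟩ := ha
  exact ⟨_, adjoint_mem_leftAlg c hc, s, hs, t, ht, _, adjoint_mem_rightAlg d hd, by
    rw [adjoint_blockOp, adjoint_adjoint]⟩

theorem blockMap_mem (h : IsCornerSystem T X P Q Q')
    {a : WithLp 2 (K × H) →L[ℂ] WithLp 2 (K × H)}
    (ha : a ∈ linkingAlgebra (T : Set (H →L[ℂ] K))) :
    blockMap P Q Q' a ∈ linkingAlgebra (X : Set (H →L[ℂ] K)) := by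
  obtain ⟨c, hc, t, ht, s, hs, d, hd, rfl⟩ := ha
  rw [blockMap_blockOp]
  exact ⟨_, h.Q_mem hc, _, h.P_mem ht, _, h.P_mem hs, _, h.Q'_mem hd, rfl⟩

theorem blockMap_adjoint (h : IsCornerSystem T X P Q Q')
    {a : WithLp 2 (K × H) →L[ℂ] WithLp 2 (K × H)}
    (ha : a ∈ linkingAlgebra (T : Set (H →L[ℂ] K))) :
    blockMap P Q Q' (adjoint a) = adjoint (blockMap P Q Q' a) := by
  obtain ⟨c, hc, t, ht, s, hs, d, hd, rfl⟩ := ha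
  rw [adjoint_blockOp, adjoint_adjoint, blockMap_blockOp, blockMap_blockOp, adjoint_blockOp,
    adjoint_adjoint, h.Q_adjoint hc, h.Q'_adjoint hd]

theorem comp_mem_and_blockMap_comp (h : IsCornerSystem T X P Q Q')
    {a b : WithLp 2 (K × H) →L[ℂ] WithLp 2 (K × H)}
    (ha : a ∈ linkingAlgebra (T : Set (H →L[ℂ] K)))
    (hb : b ∈ linkingAlgebra (X : Set (H →L[ℂ] K))) :
    a ∘L b ∈ linkingAlgebra (T : Set (H →L[ℂ] K)) ∧
      blockMap P Q Q' (a ∘L b) = blockMap P Q Q' a ∘L b := by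
  obtain ⟨c, hc, t, ht, s, hs, d, hd, rfl⟩ := ha
  obtain ⟨c', hc', x, hx, y, hy, d', hd', rfl⟩ := hb
  replace hc : c ∈ leftAlg T := hc
  replace hd : d ∈ rightAlg T := hd
  replace hc' : c' ∈ leftAlg X := hc'
  replace hd' : d' ∈ rightAlg X := hd'
  replace ht : t ∈ T := ht
  replace hs : s ∈ T := hs
  replace hx : x ∈ X := hx
  replace hy : y ∈ X := hy
  have hcc := h.ternary.leftAlg_comp_leftAlg_mem hc (leftAlg_mono h.le hc')
  have hty := comp_adjoint_mem_leftAlg ht (h.le hy)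
  have hcx := h.ternary.leftAlg_comp_mem hc (h.le hx)
  have htd := h.ternary.comp_rightAlg_mem (rightAlg_mono h.le hd') ht
  have hcs := h.ternary.leftAlg_comp_mem (leftAlg_mono h.le (adjoint_mem_leftAlg _ hc')) hs
  have hyd := h.ternary.comp_rightAlg_mem (adjoint_mem_rightAlg _ hd) (h.le hy)
  have hsx := adjoint_comp_mem_rightAlg hs (h.le hx)
  have hdd := h.ternary.rightAlg_comp_rightAlg_mem hd (rightAlg_mono h.le hd')
  have hprod : blockOp c t (adjoint s) d ∘L blockOp c' x (adjoint y) d' =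
      blockOp (c ∘L c' + t ∘L adjoint y) (c ∘L x + t ∘L d')
        (adjoint (adjoint c' ∘L s + y ∘L adjoint d)) (adjoint s ∘L x + d ∘L d') := by
    rw [blockOp_comp, map_add, adjoint_comp, adjoint_comp, adjoint_adjoint, adjoint_adjoint]
  rw [hprod]
  refine ⟨⟨_, add_mem hcc hty, _, add_mem hcx htd, _, add_mem hcs hyd, _, add_mem hsx hdd, rfl⟩,
    ?_⟩
  rw [blockMap_blockOp, blockMap_blockOp, blockOp_comp, h.Q_linear.map_add _ hcc _ hty,
    h.P_linear.map_add _ hcx _ htd, h.P_linear.map_add _ hcs _ hyd,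
    h.Q'_linear.map_add _ hsx _ hdd, h.Q_comp_subLeft hc hc', h.Q_comp_adjoint ht hy,
    h.P_left_comp hc hx, h.P_comp_subRight hd' ht, h.P_subLeft_comp (adjoint_mem_leftAlg _ hc') hs,
    h.P_comp_right (adjoint_mem_rightAlg _ hd) hy, h.Q'_adjoint hd, h.Q'_adjoint_comp_sub hs hx,
    h.Q'_comp_subRight hd hd', map_add, adjoint_comp, adjoint_comp, adjoint_adjoint,
    adjoint_adjoint]

theorem comp_mem (h : IsCornerSystem T X P Q Q')
    {a b : WithLp 2 (K × H) →L[ℂ] WithLp 2 (K × H)}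
    (ha : a ∈ linkingAlgebra (T : Set (H →L[ℂ] K)))
    (hb : b ∈ linkingAlgebra (X : Set (H →L[ℂ] K))) :
    a ∘L b ∈ linkingAlgebra (T : Set (H →L[ℂ] K)) :=
  (h.comp_mem_and_blockMap_comp ha hb).1

theorem blockMap_comp (h : IsCornerSystem T X P Q Q')
    {a b : WithLp 2 (K × H) →L[ℂ] WithLp 2 (K × H)}
    (ha : a ∈ linkingAlgebra (T : Set (H →L[ℂ] K)))
    (hb : b ∈ linkingAlgebra (X : Set (H →L[ℂ] K))) :
    blockMap P Q Q' (a ∘L b) = blockMap P Q Q' a ∘L b :=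
  (h.comp_mem_and_blockMap_comp ha hb).2

theorem blockMap_comp_left (h : IsCornerSystem T X P Q Q')
    {a b : WithLp 2 (K × H) →L[ℂ] WithLp 2 (K × H)}
    (ha : a ∈ linkingAlgebra (T : Set (H →L[ℂ] K)))
    (hb : b ∈ linkingAlgebra (X : Set (H →L[ℂ] K))) :
    blockMap P Q Q' (b ∘L a) = b ∘L blockMap P Q Q' a := by
  have ha' := adjoint_mem_linkingAlgebra ha
  have hb' := adjoint_mem_linkingAlgebra hb
  rw [show b ∘L a = adjoint (adjoint a ∘L adjoint b) by simp [adjoint_comp],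
    h.blockMap_adjoint (h.comp_mem ha' hb'), h.blockMap_comp ha' hb', h.blockMap_adjoint ha,
    adjoint_comp, adjoint_adjoint, adjoint_adjoint]

theorem column_mem_linkingAlgebra {b : WithLp 2 (K × H) →L[ℂ] WithLp 2 (K × H)}
    (hb : b ∈ columns X) : b ∈ linkingAlgebra (X : Set (H →L[ℂ] K)) := by
  obtain ⟨x, hx, d, hd, rfl⟩ := hb
  exact ⟨0, (leftAlg X).zero_mem, x, hx, 0, X.zero_mem, d, hd, by simp⟩

theorem blockMap_column (h : IsCornerSystem T X P Q Q') (t : H →L[ℂ] K) (d : H →L[ℂ] H) :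
    blockMap P Q Q' (blockOp 0 t 0 d) = blockOp 0 (P t) 0 (Q' d) := by
  simpa [h.Q_linear.map_zero, h.P_linear.map_zero] using blockMap_blockOp P Q Q' 0 t 0 d

theorem norm_blockMap_lower_right_le (h : IsCornerSystem T X P Q Q') {d : H →L[ℂ] H}
    (hd : d ∈ rightAlg T) :
    ‖blockMap P Q Q' (blockOp 0 0 0 d)‖ ≤ ‖blockOp (0 : K →L[ℂ] K) 0 0 d‖ := by
  rw [h.blockMap_column, h.P_linear.map_zero]
  exact (norm_blockOp_lower_right_le _).trans
    ((h.right.2.2.2.1 d hd).trans (norm_le_norm_blockOp_lower_right d))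

theorem norm_blockMap_column_le (h : IsCornerSystem T X P Q Q')
    {v : WithLp 2 (K × H) →L[ℂ] WithLp 2 (K × H)} (hv : v ∈ columns T) :
    ‖blockMap P Q Q' v‖ ≤ ‖v‖ := by
  have hvT := column_mem_linkingAlgebra hv
  have hmem : ∃ d ∈ rightAlg T, adjoint (blockMap P Q Q' v) ∘L v = blockOp 0 0 0 d := by
    obtain ⟨t, ht, d, hd, rfl⟩ := hv
    refine ⟨adjoint (P t) ∘L t + adjoint (Q' d) ∘L d,
      add_mem (adjoint_comp_mem_rightAlg (h.le (h.P_mem ht)) ht)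
        (h.ternary.rightAlg_comp_rightAlg_mem
          (adjoint_mem_rightAlg _ (rightAlg_mono h.le (h.Q'_mem hd))) hd), ?_⟩
    rw [h.blockMap_column, adjoint_blockOp, blockOp_comp]
    simp
  obtain ⟨d, hd, hEv⟩ := hmem
  have key : ‖blockMap P Q Q' v‖ * ‖blockMap P Q Q' v‖ ≤ ‖blockMap P Q Q' v‖ * ‖v‖ := by
    calc ‖blockMap P Q Q' v‖ * ‖blockMap P Q Q' v‖
        = ‖blockMap P Q Q' (adjoint (blockMap P Q Q' v) ∘L v)‖ := by
          rw [h.blockMap_comp_left hvT (adjoint_mem_linkingAlgebra (h.blockMap_mem hvT)),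
            norm_adjoint_comp_self]
      _ ≤ ‖adjoint (blockMap P Q Q' v) ∘L v‖ := by
          rw [hEv]; exact h.norm_blockMap_lower_right_le hd
      _ ≤ ‖adjoint (blockMap P Q Q' v)‖ * ‖v‖ := ContinuousLinearMap.opNorm_comp_le _ _
      _ = ‖blockMap P Q Q' v‖ * ‖v‖ := by rw [LinearIsometryEquiv.norm_map]
  rcases (norm_nonneg (blockMap P Q Q' v)).eq_or_lt with h0 | h0
  · rw [← h0]; exact norm_nonneg v
  · exact le_of_mul_le_mul_left key h0

theorem comp_column_mem (hT : IsTernaryRing T) {a b : WithLp 2 (K × H) →L[ℂ] WithLp 2 (K × H)}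
    (ha : a ∈ linkingAlgebra (T : Set (H →L[ℂ] K))) (hb : b ∈ columns T) :
    a ∘L b ∈ columns T := by
  obtain ⟨c, hc, t, ht, s, hs, d, hd, rfl⟩ := ha
  obtain ⟨x, hx, d', hd', rfl⟩ := hb
  refine ⟨c ∘L x + t ∘L d', add_mem (hT.leftAlg_comp_mem hc hx) (hT.comp_rightAlg_mem hd' ht),
    adjoint s ∘L x + d ∘L d', add_mem (adjoint_comp_mem_rightAlg hs hx)
      (hT.rightAlg_comp_rightAlg_mem hd hd'), ?_⟩
  rw [blockOp_comp]
  simp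

theorem norm_blockMap_comp_column_le (h : IsCornerSystem T X P Q Q')
    {a b : WithLp 2 (K × H) →L[ℂ] WithLp 2 (K × H)}
    (ha : a ∈ linkingAlgebra (T : Set (H →L[ℂ] K))) (hb : b ∈ columns X) :
    ‖blockMap P Q Q' a ∘L b‖ ≤ ‖a‖ * ‖b‖ := by
  have hbT : b ∈ columns T := by
    obtain ⟨x, hx, d, hd, rfl⟩ := hb
    exact ⟨x, h.le hx, d, rightAlg_mono h.le hd, rfl⟩
  rw [← h.blockMap_comp ha (column_mem_linkingAlgebra hb)]
  exact (h.norm_blockMap_column_le (comp_column_mem h.ternary ha hbT)).trans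
    (ContinuousLinearMap.opNorm_comp_le _ _)

theorem blockOp_mem_closedSpan_columns {x y : H →L[ℂ] K} {d e : H →L[ℂ] H} (hx : x ∈ X)
    (hd : d ∈ rightAlg X) (hy : y ∈ X) (he : e ∈ rightAlg X) :
    blockOp (x ∘L adjoint y) (x ∘L e) (d ∘L adjoint y) (d ∘L e) ∈
      closedSpan (setMulStar (columns X) (columns X)) := by
  refine subset_closedSpan ⟨_, ⟨x, hx, d, hd, rfl⟩, _, ⟨y, hy, _, adjoint_mem_rightAlg e he, rfl⟩,
    ?_⟩
  rw [adjoint_blockOp, blockOp_comp]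
  simp

theorem upper_left_mem_closedSpan_columns {c : K →L[ℂ] K} (hc : c ∈ leftAlg X) :
    blockOp c (0 : H →L[ℂ] K) 0 0 ∈ closedSpan (setMulStar (columns X) (columns X)) := by
  have hA : ∀ c : K →L[ℂ] K, (compLeft inlOp ∘L compRight (WithLp.fstL 2 ℂ K H)) c =
      blockOp c 0 0 0 := fun c =>
    ContinuousLinearMap.ext fun v => WithLp.ofLp_injective 2 (by simp)
  rw [← hA]
  refine closedSpan_induction _ (isClosed_closedSpan _) ?_ c hc
  rintro _ ⟨x, hx, y, hy, rfl⟩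
  rw [hA]
  simpa using blockOp_mem_closedSpan_columns hx (zero_mem (rightAlg X)) hy (zero_mem _)

theorem upper_right_mem_closedSpan_columns (h : IsCornerSystem T X P Q Q') {t : H →L[ℂ] K}
    (ht : t ∈ X) :
    blockOp (0 : K →L[ℂ] K) t 0 0 ∈ closedSpan (setMulStar (columns X) (columns X)) := by
  have hA : ∀ t : H →L[ℂ] K, (compLeft inlOp ∘L compRight (WithLp.sndL 2 ℂ K H)) t =
      blockOp 0 t 0 0 := fun t =>
    ContinuousLinearMap.ext fun v => WithLp.ofLp_injective 2 (by simp)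
  rw [← hA]
  refine closedSpan_induction _ (isClosed_closedSpan _) ?_ t (h.sub_le_closedSpan ht)
  rintro _ ⟨x, hx, d, hd, rfl⟩
  rw [hA]
  simpa using blockOp_mem_closedSpan_columns hx (zero_mem (rightAlg X)) (zero_mem X) hd

theorem lower_right_mem_closedSpan_columns (h : IsCornerSystem T X P Q Q') {d : H →L[ℂ] H}
    (hd : d ∈ rightAlg X) :
    blockOp (0 : K →L[ℂ] K) 0 0 d ∈ closedSpan (setMulStar (columns X) (columns X)) := by
  have hA : ∀ d : H →L[ℂ] H, (compLeft inrOp ∘L compRight (WithLp.sndL 2 ℂ K H)) d =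
      blockOp 0 0 0 d := fun d =>
    ContinuousLinearMap.ext fun v => WithLp.ofLp_injective 2 (by simp)
  have hB : ∀ y z : H →L[ℂ] K,
      ((compLeft inrOp ∘L compRight (WithLp.sndL 2 ℂ K H)) ∘L compLeft (adjoint y)) z =
        blockOp 0 0 0 (adjoint y ∘L z) := fun y z =>
    ContinuousLinearMap.ext fun v => WithLp.ofLp_injective 2 (by simp)
  rw [← hA]
  refine closedSpan_induction _ (isClosed_closedSpan _) ?_ d hd
  rintro _ ⟨y, hy, z, hz, rfl⟩
  rw [hA, ← hB]
  refine closedSpan_induction _ (isClosed_closedSpan _) ?_ z (h.sub_le_closedSpan hz)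
  rintro _ ⟨x, hx, e, he, rfl⟩
  rw [hB, ← ContinuousLinearMap.comp_assoc]
  simpa using blockOp_mem_closedSpan_columns (zero_mem X) (adjoint_comp_mem_rightAlg hy hx)
    (zero_mem X) he

/-- The linking algebra of `X` lies in the closed span of the products of columns and rows. -/
theorem linkingAlgebra_subset_closedSpan (h : IsCornerSystem T X P Q Q') :
    linkingAlgebra (X : Set (H →L[ℂ] K)) ⊆
      closedSpan (setMulStar (columns X) (columns X)) := by
  rintro _ ⟨c, hc, t, ht, s, hs, d, hd, rfl⟩
  have hstar : blockOp (0 : K →L[ℂ] K) 0 (adjoint s) 0 ∈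
      closedSpan (setMulStar (columns X) (columns X)) := by
    have hs' : adjoint (blockOp (0 : K →L[ℂ] K) s 0 0) ∈
        closedSpan (setMulStar (columns X) (columns X)) := by
      refine adjoint_mem_closedSpan (isClosed_closedSpan _) ?_ _
        (h.upper_right_mem_closedSpan_columns hs)
      rintro _ ⟨a, ha, b, hb, rfl⟩
      exact subset_closedSpan ⟨b, hb, a, ha, by simp [adjoint_comp]⟩
    rw [adjoint_blockOp] at hs'
    simpa using hs'
  have hsum := add_mem (add_mem (upper_left_mem_closedSpan_columns hc)
    (h.upper_right_mem_closedSpan_columns ht))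
    (add_mem hstar (h.lower_right_mem_closedSpan_columns hd))
  simpa [blockOp_add] using hsum

theorem norm_blockMap_le (h : IsCornerSystem T X P Q Q')
    {a : WithLp 2 (K × H) →L[ℂ] WithLp 2 (K × H)}
    (ha : a ∈ linkingAlgebra (T : Set (H →L[ℂ] K))) : ‖blockMap P Q Q' a‖ ≤ ‖a‖ := by
  set E := blockMap P Q Q' with hE
  have ha' := adjoint_mem_linkingAlgebra ha
  have hEa := h.blockMap_mem ha
  have hEa' := adjoint_mem_linkingAlgebra hEa
  set w := adjoint (E a) * E a with hw
  have hstep : ∀ b ∈ columns X, w * b ∈ columns X ∧ ‖w * b‖ ≤ ‖a‖ ^ 2 * ‖b‖ := by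
    intro b hb
    have hb₁ := comp_column_mem h.sub_ternary hEa hb
    refine ⟨by simpa [hw, mul_assoc] using! comp_column_mem h.sub_ternary hEa' hb₁, ?_⟩
    calc ‖w * b‖ = ‖E (adjoint a) ∘L (E a ∘L b)‖ := by rw [hE, h.blockMap_adjoint ha]; rfl
      _ ≤ ‖adjoint a‖ * ‖E a ∘L b‖ := h.norm_blockMap_comp_column_le ha' hb₁
      _ ≤ ‖a‖ * (‖a‖ * ‖b‖) := by
          rw [LinearIsometryEquiv.norm_map]
          gcongr
          exact h.norm_blockMap_comp_column_le ha hb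
      _ = ‖a‖ ^ 2 * ‖b‖ := by ring
  have hpow : ∀ b ∈ columns X, ∀ n : ℕ, w ^ n * b ∈ columns X ∧
      ‖w ^ n * b‖ ≤ (‖a‖ ^ 2) ^ n * ‖b‖ := by
    intro b hb n
    induction n with
    | zero => simpa using hb
    | succ n ih =>
      rw [pow_succ', mul_assoc]
      refine ⟨(hstep _ ih.1).1, (hstep _ ih.1).2.trans ?_⟩
      rw [pow_succ' (‖a‖ ^ 2), mul_assoc]
      exact mul_le_mul_of_nonneg_left ih.2 (by positivity)
  have hwX : w ∈ linkingAlgebra (X : Set (H →L[ℂ] K)) := by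
    have hmem := h.blockMap_mem (h.comp_mem ha' hEa)
    rwa [h.blockMap_comp ha' hEa, h.blockMap_adjoint ha] at hmem
  have hnorm : ‖w‖ ≤ ‖a‖ ^ 2 := by
    refine IsSelfAdjoint.norm_le_of_norm_pow_mul_le (IsSelfAdjoint.star_mul_self (E a))
      (h.linkingAlgebra_subset_closedSpan hwX) (by positivity) ?_
    rintro _ ⟨b, hb, b', hb', rfl⟩
    refine ⟨‖b‖ * ‖adjoint b'‖, fun n => ?_⟩
    calc ‖w ^ n * (b ∘L adjoint b')‖ = ‖(w ^ n * b) * adjoint b'‖ := by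
          rw [mul_assoc]; rfl
      _ ≤ (‖a‖ ^ 2) ^ n * ‖b‖ * ‖adjoint b'‖ :=
          (norm_mul_le _ _).trans (by gcongr; exact (hpow b hb n).2)
      _ = ‖b‖ * ‖adjoint b'‖ * (‖a‖ ^ 2) ^ n := by ring
  have hsq : ‖E a‖ * ‖E a‖ ≤ ‖a‖ ^ 2 := by
    rw [← norm_adjoint_comp_self]; exact hnorm
  exact abs_le_of_sq_le_sq' (by rwa [sq]) (norm_nonneg a) |>.2

theorem isCondExp_blockMap (h : IsCornerSystem T X P Q Q') :
    IsCondExp (linkingAlgebra (T : Set (H →L[ℂ] K))) (linkingAlgebra (X : Set (H →L[ℂ] K)))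
      (blockMap P Q Q') := by
  refine ⟨?_, ?_, fun a ha => h.norm_blockMap_le ha, fun a ha => h.blockMap_mem ha, ?_,
    fun a ha b hb => ⟨h.blockMap_comp ha hb, h.blockMap_comp_left ha hb⟩⟩
  · rintro _ ⟨c, hc, t, ht, s, hs, d, hd, rfl⟩ _ ⟨c', hc', t', ht', s', hs', d', hd', rfl⟩
    rw [blockOp_add, ← map_add, blockMap_blockOp, blockMap_blockOp, blockMap_blockOp, blockOp_add,
      h.Q_linear.map_add c hc c' hc', h.P_linear.map_add t ht t' ht',
      h.P_linear.map_add s hs s' hs', h.Q'_linear.map_add d hd d' hd', map_add]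
  · rintro z _ ⟨c, hc, t, ht, s, hs, d, hd, rfl⟩
    have hz : ∀ s : H →L[ℂ] K, z • adjoint s = adjoint (star z • s) := fun s => by
      simp [map_smulₛₗ]
    rw [smul_blockOp, hz, blockMap_blockOp, blockMap_blockOp, smul_blockOp, hz,
      h.Q_linear.map_smul z c hc, h.P_linear.map_smul z t ht, h.P_linear.map_smul _ s hs,
      h.Q'_linear.map_smul z d hd]
  · rintro _ ⟨c, hc, t, ht, s, hs, d, hd, rfl⟩
    rw [blockMap_blockOp, h.Q_eq_self hc, h.P_eq_self ht, h.P_eq_self hs, h.Q'_eq_self hd]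

end IsCornerSystem

/-- The block map `E = [[Q, P], [P†, Q']]` is a well-defined conditional
expectation from the linking algebra `A_T` onto the linking algebra `A_X`. -/
theorem block_map_is_conditional_expectation
    (T X : Set (H →L[ℂ] K)) (P : (H →L[ℂ] K) → (H →L[ℂ] K))
    (Q : (K →L[ℂ] K) → (K →L[ℂ] K)) (Q' : (H →L[ℂ] H) → (H →L[ℂ] H))
    (hT : IsTRO T) (hX : IsSubTRO T X) (hXnd : Nondegenerate T X)
    (hP : IsTROCondExp T X P) (hPc : ContractiveOn T P)
    (hQ : IsLeftCornerMap T X P Q) (hQ' : IsRightCornerMap T X P Q') :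
    ∃ E : (WithLp 2 (K × H) →L[ℂ] WithLp 2 (K × H)) →
        (WithLp 2 (K × H) →L[ℂ] WithLp 2 (K × H)),
      -- `E` is given in block form: in particular it is well defined by the blocks
      (∀ c ∈ cspan (setMulStar T T), ∀ t ∈ T, ∀ s ∈ T, ∀ d ∈ cspan (setStarMul T T),
        E (blockOp c t (ContinuousLinearMap.adjoint s) d)
          = blockOp (Q c) (P t) (ContinuousLinearMap.adjoint (P s)) (Q' d)) ∧
      -- and `E` is a conditional expectation from `A_T` onto `A_X`
      IsCondExp (linkingAlgebra T) (linkingAlgebra X) E := by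
  obtain ⟨hTc, ⟨T, rfl⟩, hTtp⟩ := hT
  obtain ⟨hle, hXc, ⟨X, rfl⟩, hXtp⟩ := hX
  have h : IsCornerSystem T X P Q Q' :=
    ⟨⟨hTc, hTtp⟩, ⟨hXc, hXtp⟩, hle, hXnd, hP, hPc, hQ, hQ'⟩
  exact ⟨blockMap P Q Q', fun c _ t _ s _ d _ => blockMap_blockOp P Q Q' c t s d,
    h.isCondExp_blockMap⟩
end
end
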